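/- There exists a probability measure ν₀ on ℂ whose support equals the union of the three straight segments joining 0 to (3/4)·e^{2πij/3}, j = 0, 1, 2, with the following property: for every sequence (a_n) of complex numbers with lim_{n→∞} a_n/n^{2/3} = 0, the root-counting measures μ_n of the polynomials β ↦ Sp_n(a_n, n^{4/3}·β) converge weakly to ν₀ as n → ∞, i.e., ∫ f dμ_n → ∫ f dν₀ for every bounded continuous function f : ℂ → ℝ. -/

import Mathlib

open Filter MeasureTheory BoundedContinuousFunction
open scoped ENNReal

/-- The `(n+1) × (n+1)` matrix `M_n^{(a)}` of the operator
`T_n(y) = y'' - (x² - a) y' + n x y` in the monomial basis `1, x, …, xⁿ`. -/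
def Mmat (n : ℕ) (a : ℂ) : Matrix (Fin (n + 1)) (Fin (n + 1)) ℂ :=
  Matrix.of fun i j =>
    if (j : ℕ) = (i : ℕ) + 1 then ((i : ℕ) + 1 : ℂ) * a
    else if (j : ℕ) = (i : ℕ) + 2 then ((i : ℕ) + 1 : ℂ) * ((i : ℕ) + 2 : ℂ)
    else if (i : ℕ) = (j : ℕ) + 1 then (n : ℂ) - (j : ℕ)
    else 0

/-- The spectral polynomial `Sp_n(a, λ) = det (M_n^{(a)} - λ·Id)` as a polynomial
in the variable `λ`. -/
noncomputable def SpPoly (n : ℕ) (a : ℂ) : Polynomial ℂ :=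
  Matrix.det
    ((Mmat n a).map Polynomial.C -
      (Polynomial.X : Polynomial ℂ) • (1 : Matrix (Fin (n + 1)) (Fin (n + 1)) (Polynomial ℂ)))

/-- The root-counting measure of the degree-`(n+1)` polynomial
`β ↦ Sp_n(a, n^{4/3}·β)`: each root (counted with multiplicity) carries mass `1/(n+1)`.
Its roots are the roots of `Sp_n(a, ·)` divided by `n^{4/3}`. -/
noncomputable def rootMeasure (n : ℕ) (a : ℂ) : Measure ℂ :=
  (((n : ℝ≥0∞) + 1))⁻¹ •
    (((SpPoly n a).roots.map
      (fun z => z / (((n : ℝ) ^ ((4 : ℝ) / 3) : ℝ) : ℂ))).map Measure.dirac).sum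


open Polynomial in
theorem det_aeval_eq {m : Type*} [Fintype m] [DecidableEq m] (M : Matrix m m ℂ) (q : ℂ[X]) (hq : q ≠ 0) :
    (aeval M q).det = (M.charpoly.roots.map (fun z => q.eval z)).prod := by
  have hs : ∀ s : ℂ, (M - algebraMap ℂ (Matrix m m ℂ) s).det = (M.charpoly.roots.map (fun z => z - s)).prod := by
    intro s
    have h1 := Matrix.eval_charpoly M s
    have h2 : (M - algebraMap ℂ (Matrix m m ℂ) s) = -(Matrix.scalar m s - M) := by
      rw [neg_sub]; rfl
    rw [h2, Matrix.det_neg, ← h1]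
    have h3 := (IsAlgClosed.splits M.charpoly).eval_eq_prod_roots_of_monic M.charpoly_monic s
    have hc : M.charpoly.roots.card = Fintype.card m := by
      rw [IsAlgClosed.card_roots_eq_natDegree, M.charpoly_natDegree_eq_dim]
    rw [h3, ← hc, ← Multiset.card_map (fun z => s - z), ← Multiset.prod_map_neg, Multiset.map_map]
    congr 1
    apply Multiset.map_congr rfl
    intro x _; simp
  have hq' := (IsAlgClosed.splits q).eq_prod_roots
  have key : ∀ t : Multiset ℂ, (aeval M ((t.map (fun a => X - Polynomial.C a)).prod)).det = (M.charpoly.roots.map (fun z => ((t.map (fun a => X - Polynomial.C a)).prod).eval z)).prod := by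
    intro t
    induction t using Multiset.induction_on with
    | empty => simp
    | cons a t ih =>
      rw [Multiset.map_cons, Multiset.prod_cons, map_mul, Matrix.det_mul, ih]
      simp only [eval_mul, Multiset.prod_map_mul]
      congr 1
      simpa using hs a
  have hc : M.charpoly.roots.card = Fintype.card m := by
      rw [IsAlgClosed.card_roots_eq_natDegree, M.charpoly_natDegree_eq_dim]
  rw [hq', map_mul, Matrix.det_mul, key]
  simp only [eval_mul, Multiset.prod_map_mul, eval_C, Multiset.map_const', Multiset.prod_replicate, hc]
  congr 1
  rw [aeval_C, Matrix.algebraMap_eq_diagonal, Matrix.det_diagonal]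
  simp

open Polynomial in
theorem trace_pow_eq {m : Type*} [Fintype m] [DecidableEq m] (M : Matrix m m ℂ) (k : ℕ) :
    (M ^ k).trace = (M.charpoly.roots.map (fun z => z ^ k)).sum := by
  have h : (M ^ k).charpoly = ((M.charpoly.roots.map (fun z => z ^ k)).map (fun z => X - Polynomial.C z)).prod := by
    have key : ∀ x : ℂ, (Polynomial.C x - X ^ k : ℂ[X]) ≠ 0 → (M ^ k).charpoly.eval x = (((M.charpoly.roots.map (fun z => z ^ k)).map (fun z => X - Polynomial.C z)).prod).eval x := by
      intro x hx
      rw [Matrix.eval_charpoly, eval_multiset_prod, Multiset.map_map, Multiset.map_map]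
      have h1 := det_aeval_eq M (Polynomial.C x - X ^ k) hx
      rw [map_sub, aeval_C, map_pow, aeval_X] at h1
      refine Eq.trans h1 ?_
      congr 1
      apply Multiset.map_congr rfl
      intro z _
      simp
    apply Polynomial.eq_of_infinite_eval_eq
    refine Set.Infinite.mono (s := {x : ℂ | x ≠ 1}) ?_ ?_
    · intro x hx
      refine key x ?_
      intro h0
      apply hx
      have := congrArg (eval 1) h0
      simpa [sub_eq_zero] using this
    · exact (Set.finite_singleton (1:ℂ)).infinite_compl
  rw [Matrix.trace_eq_sum_roots_charpoly, h, roots_multiset_prod_X_sub_C]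

structure ConeInv (F : ℂ) (η δ₁ δ₂ : ℝ) (q p : ℂ) : Prop where
  p1 : -δ₁ ≤ p.im
  q1 : -δ₁ ≤ q.im
  p2 : (F * p).im ≤ -η
  q2 : (F * q).im ≤ -η
  qp3 : (F * (q * p)).im ≤ 0
  qp4 : -δ₂ ≤ (q * p).im

theorem inv_norm_le_of_im {F z : ℂ} {η : ℝ} (hη : 0 < η) (hF : ‖F‖ = 1) (h : (F * z).im ≤ -η) :
    ‖z‖⁻¹ ≤ η⁻¹ ∧ z ≠ 0 := by
  have h1 : η ≤ ‖z‖ := by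
    have := Complex.abs_im_le_norm (F * z)
    rw [norm_mul, hF, one_mul] at this
    have h2 := neg_abs_le (F * z).im
    linarith
  refine ⟨inv_anti₀ hη h1, ?_⟩
  rintro rfl
  simp at h1; linarith

theorem cone_step {E F b q p r : ℂ} {R s c C ε η δ₁ δ₂ : ℝ} (hR : 0 < R) (hs : 0 < s)
    (hFE : F * E = 1) (hF : ‖F‖ = 1) (hFs : F.im = -s) (hη : η = R * s / 2)
    (hδ₁ : δ₁ = ε * η⁻¹) (hδ₂ : δ₂ = R * δ₁ + ε) (hc : 0 ≤ c) (hcC : c ≤ C) (hb : ‖b‖ ≤ ε)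
    (c1 : ε * η⁻¹ + C * (δ₂ * (η⁻¹) ^ 4) ≤ η) (c2 : ε + C * (δ₁ * (η⁻¹) ^ 2) ≤ R * η)
    (h : ConeInv F η δ₁ δ₂ q p) (hr : r = R + b / q + c * E / (q * p)) :
    ConeInv F η δ₁ δ₂ r q := by
  have hη0 : 0 < η := by rw [hη]; positivity
  have hε : 0 ≤ ε := (norm_nonneg _).trans hb
  have hδ₁0 : 0 ≤ δ₁ := by rw [hδ₁]; positivity
  have hδ₂0 : 0 ≤ δ₂ := by rw [hδ₂]; positivity
  have hC : 0 ≤ C := hc.trans hcC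
  have hF0 : F ≠ 0 := by rintro rfl; simp at hF
  have hE : E = F⁻¹ := by field_simp; linear_combination hFE
  obtain ⟨hqi, hq0⟩ := inv_norm_le_of_im hη0 hF h.q2
  obtain ⟨hpi, hp0⟩ := inv_norm_le_of_im hη0 hF h.p2
  have him : ∀ z : ℂ, z.im ≤ 0 → 0 ≤ (z⁻¹).im := by
    intro z hz
    rw [Complex.inv_im]
    apply div_nonneg (by linarith) (Complex.normSq_nonneg _)
  have him2 : ∀ (z : ℂ) (d : ℝ), 0 ≤ d → -d ≤ z.im → (z⁻¹).im ≤ d * (‖z‖⁻¹) ^ 2 := by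
    intro z d hd hz
    rw [Complex.inv_im, Complex.normSq_eq_norm_sq, inv_pow, div_eq_mul_inv]
    gcongr; linarith
  have hbq : ‖b / q‖ ≤ ε * η⁻¹ := by
    rw [norm_div, div_eq_mul_inv]; gcongr
  refine ⟨h.q1, ?_, h.q2, ?_, ?_, ?_⟩
  · have e1 : r = R + b / q + c * (F * (q * p))⁻¹ := by
      rw [hr, hE]; field_simp
    rw [e1, hδ₁]
    have := him _ h.qp3
    have h2 := Complex.abs_im_le_norm (b / q)
    have h3 := neg_abs_le (b / q).im
    simp only [Complex.add_im, Complex.ofReal_im, Complex.im_ofReal_mul]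
    nlinarith [mul_nonneg hc this]
  · have e1 : F * r = R * F + F * (b / q) + c * (q * p)⁻¹ := by
      rw [hr, hE]; field_simp
    rw [e1]
    have h1 := him2 (q * p) δ₂ hδ₂0 h.qp4
    have h4 : (‖q * p‖⁻¹) ^ 2 ≤ (η⁻¹) ^ 4 := by
      rw [norm_mul, mul_inv]
      calc (‖q‖⁻¹ * ‖p‖⁻¹) ^ 2 ≤ (η⁻¹ * η⁻¹) ^ 2 := by gcongr
        _ = _ := by ring
    have h5 : c * ((q * p)⁻¹).im ≤ C * (δ₂ * (η⁻¹) ^ 4) := by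
      calc c * ((q * p)⁻¹).im ≤ c * (δ₂ * (η⁻¹) ^ 4) := by
            gcongr
            exact h1.trans (by gcongr)
        _ ≤ _ := by gcongr
    have h2 := Complex.abs_im_le_norm (F * (b / q))
    have h3 := le_abs_self (F * (b / q)).im
    rw [norm_mul, hF, one_mul] at h2
    simp only [Complex.add_im, Complex.im_ofReal_mul, hFs]
    nlinarith
  · have e1 : F * (r * q) = R * (F * q) + F * b + c * p⁻¹ := by
      rw [hr, hE]; field_simp
    rw [e1]
    have h1 := him2 p δ₁ hδ₁0 h.p1
    have h5 : c * (p⁻¹).im ≤ C * (δ₁ * (η⁻¹) ^ 2) := by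
      calc c * (p⁻¹).im ≤ c * (δ₁ * (η⁻¹) ^ 2) := by
            gcongr
            exact h1.trans (by gcongr)
        _ ≤ _ := by gcongr
    have h2 := Complex.abs_im_le_norm (F * b)
    have h3 := le_abs_self (F * b).im
    rw [norm_mul, hF, one_mul] at h2
    simp only [Complex.add_im, Complex.im_ofReal_mul]
    nlinarith [h.q2]
  · have e1 : r * q = R * q + b + c * (F * p)⁻¹ := by
      rw [hr, hE]; field_simp
    rw [e1]
    have h1 := him (F * p) (h.p2.trans (by linarith))
    have h2 := Complex.abs_im_le_norm b
    have h3 := neg_abs_le b.im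
    simp only [Complex.add_im, Complex.im_ofReal_mul]
    rw [hδ₂]
    nlinarith [h.q1, mul_nonneg hc h1]

/-- Non-vanishing of solutions of the perturbed recurrence. -/
theorem cone_nonvanish {E F : ℂ} {R s C ε η δ₁ δ₂ : ℝ} (hR : 0 < R) (hs : 0 < s)
    (hFE : F * E = 1) (hF : ‖F‖ = 1) (hFs : F.im = -s) (hη : η = R * s / 2)
    (hδ₁ : δ₁ = ε * η⁻¹) (hδ₂ : δ₂ = R * δ₁ + ε)
    (c1 : ε * η⁻¹ + C * (δ₂ * (η⁻¹) ^ 4) ≤ η) (c2 : ε + C * (δ₁ * (η⁻¹) ^ 2) ≤ R * η)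
    (n : ℕ) (y b : ℕ → ℂ) (c : ℕ → ℝ) (hn : 1 ≤ n) (hb : ∀ k ≤ n, ‖b k‖ ≤ ε)
    (hc : ∀ k ≤ n, 0 ≤ c k) (hcC : ∀ k ≤ n, c k ≤ C) (y0 : y 0 ≠ 0) (y1 : y 1 = R * y 0)
    (y2 : y 2 = R * y 1 + b 1 * y 0)
    (hy : ∀ k, k + 2 ≤ n → y (k + 3) = R * y (k + 2) + b (k + 2) * y (k + 1) + c (k + 2) * E * y k) :
    ∀ k ≤ n + 1, y k ≠ 0 := by
  have hη0 : 0 < η := by rw [hη]; positivity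
  have hR0 : (R : ℂ) ≠ 0 := by exact_mod_cast hR.ne'
  have hε : 0 ≤ ε := (norm_nonneg _).trans (hb 0 (Nat.zero_le _))
  have hC : 0 ≤ C := (hc 0 (Nat.zero_le _)).trans (hcC 0 (Nat.zero_le _))
  have hδ₁0 : 0 ≤ δ₁ := by rw [hδ₁]; positivity
  have hδ₂0 : 0 ≤ δ₂ := by rw [hδ₂]; positivity
  have hv : ConeInv F η δ₁ δ₂ R R := by
    have e : (F * (R : ℂ)).im = -(R * s) := by
      rw [mul_comm, Complex.im_ofReal_mul, hFs]; ring
    refine ⟨by simpa, by simpa, ?_, ?_, ?_, ?_⟩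
    · rw [e, hη]; nlinarith [mul_pos hR hs]
    · rw [e, hη]; nlinarith [mul_pos hR hs]
    · rw [← mul_assoc, mul_comm, Complex.im_ofReal_mul, e]; nlinarith [mul_pos hR hs]
    · rw [← Complex.ofReal_mul, Complex.ofReal_im]; linarith
  have key : ∀ k, k + 1 ≤ n → y k ≠ 0 ∧ y (k + 1) ≠ 0 ∧ y (k + 2) ≠ 0 ∧
      ConeInv F η δ₁ δ₂ (y (k + 2) / y (k + 1)) (y (k + 1) / y k) := by
    intro k
    induction k with
    | zero =>
      intro hk
      have y1' : y 1 ≠ 0 := by rw [y1]; exact mul_ne_zero hR0 y0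
      have e1 : y 1 / y 0 = R := by rw [y1]; field_simp
      have h := cone_step (r := y 2 / y 1) hR hs hFE hF hFs hη hδ₁ hδ₂ le_rfl hC (hb 1 hn) c1 c2 hv (by
        rw [y2, y1]; field_simp; simp)
      refine ⟨y0, y1', ?_, ?_⟩
      · have := (inv_norm_le_of_im hη0 hF h.q2).2
        intro h0
        rw [h0] at this; simp at this
      · simp only [zero_add]
        rw [e1]; exact h
    | succ k ih =>
      intro hk
      obtain ⟨a0, a1, a2, hi⟩ := ih (by omega)
      have h := cone_step (r := y (k + 3) / y (k + 2)) hR hs hFE hF hFs hη hδ₁ hδ₂ (hc (k + 2) hk) (hcC (k + 2) hk) (hb (k + 2) hk) c1 c2 hi (by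
        rw [hy k hk]; field_simp)
      refine ⟨a1, a2, ?_, h⟩
      have := (inv_norm_le_of_im hη0 hF h.q2).2
      intro h0
      rw [show k + 1 + 2 = k + 3 from rfl] at h0
      rw [h0] at this; simp at this
  intro k hk
  rcases Nat.lt_or_ge k n with h | h
  · exact (key k h).1
  · rcases Nat.eq_or_lt_of_le h with h' | h'
    · obtain ⟨m, rfl⟩ : ∃ m, n = m + 1 := ⟨n - 1, by omega⟩
      rw [← h']; exact (key m le_rfl).2.1
    · obtain ⟨m, rfl⟩ : ∃ m, n = m + 1 := ⟨n - 1, by omega⟩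
      rw [show k = m + 2 by omega]; exact (key m le_rfl).2.2.1

theorem cone_uniform_pos {κ B C : ℝ} (hκ : 0 < κ) (hB : 0 < B) (hC : 0 ≤ C) :
    ∃ ε > 0, ∀ lam : ℂ, ‖lam‖ ≤ B → κ ≤ (lam ^ 3).im → ∀ (n : ℕ) (y b : ℕ → ℂ) (c : ℕ → ℝ),
      1 ≤ n → (∀ k ≤ n, ‖b k‖ ≤ ε) → (∀ k ≤ n, 0 ≤ c k) → (∀ k ≤ n, c k ≤ C) → y 0 ≠ 0 →
      y 1 = lam * y 0 → y 2 = lam * y 1 - b 1 * y 0 →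
      (∀ k, k + 2 ≤ n → y (k + 3) = lam * y (k + 2) - b (k + 2) * y (k + 1) - c (k + 2) * y k) →
      ∀ k ≤ n + 1, y k ≠ 0 := by
  obtain ⟨h, hh⟩ : ∃ h, h = κ / (2 * B ^ 2) := ⟨_, rfl⟩
  have hh0 : 0 < h := by rw [hh]; positivity
  obtain ⟨K1, hK1⟩ : ∃ K, K = h⁻¹ + C * ((B * h⁻¹ + 1) * (h⁻¹) ^ 4) := ⟨_, rfl⟩
  obtain ⟨K2, hK2⟩ : ∃ K, K = 1 + C * (h⁻¹ * (h⁻¹) ^ 2) := ⟨_, rfl⟩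
  have hK10 : 0 < K1 := by rw [hK1]; positivity
  have hK20 : 0 < K2 := by rw [hK2]; positivity
  refine ⟨min (h / K1) (κ / (2 * B) / K2), lt_min (by positivity) (by positivity), ?_⟩
  intro lam hlam him n y b c hn hb hc hcC y0 y1 y2 hy
  set ε := min (h / K1) (κ / (2 * B) / K2) with hε
  have hε0 : 0 < ε := lt_min (by positivity) (by positivity)
  have hε1 : ε * K1 ≤ h := (le_div_iff₀ hK10).1 (min_le_left _ _)
  have hε2 : ε * K2 ≤ κ / (2 * B) := (le_div_iff₀ hK20).1 (min_le_right _ _)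
  have hlam0 : lam ≠ 0 := by
    rintro rfl; simp at him; linarith
  obtain ⟨R, hR⟩ : ∃ R, R = ‖lam‖ := ⟨_, rfl⟩
  have hR0 : 0 < R := by rw [hR]; simpa
  have hRC : (R : ℂ) ≠ 0 := by exact_mod_cast hR0.ne'
  obtain ⟨u, hu⟩ : ∃ u : ℂ, u = lam / R := ⟨_, rfl⟩
  have hlu : lam = R * u := by rw [hu]; field_simp
  have hun : ‖u‖ = 1 := by
    rw [hu, norm_div, Complex.norm_real, Real.norm_of_nonneg hR0.le, hR]
    exact div_self (by simpa)
  have hu0 : u ≠ 0 := by rintro rfl; simp at hun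
  obtain ⟨s, hs⟩ : ∃ s, s = (u ^ 3).im := ⟨_, rfl⟩
  have hRs : R ^ 3 * s = (lam ^ 3).im := by
    rw [hs, hlu, mul_pow, ← Complex.ofReal_pow, Complex.im_ofReal_mul]
  have hs0 : 0 < s := by
    by_contra hcon
    have : R ^ 3 * s ≤ 0 := mul_nonpos_of_nonneg_of_nonpos (by positivity) (not_lt.1 hcon)
    linarith
  have hRB : R ≤ B := hR ▸ hlam
  have hηh : h ≤ R * s / 2 := by
    rw [hh, div_le_div_iff₀ (by positivity) (by norm_num)]
    have : κ ≤ R * s * B ^ 2 := by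
      calc κ ≤ R ^ 3 * s := by rw [hRs]; exact him
        _ = R * s * R ^ 2 := by ring
        _ ≤ _ := by gcongr
    nlinarith
  have hRη : κ / (2 * B) ≤ R * (R * s / 2) := by
    rw [div_le_iff₀ (by positivity)]
    have : κ ≤ R * R * s * B := by
      calc κ ≤ R ^ 3 * s := by rw [hRs]; exact him
        _ = R * R * s * R := by ring
        _ ≤ _ := by gcongr
    nlinarith
  have hinv : (R * s / 2)⁻¹ ≤ h⁻¹ := inv_anti₀ hh0 hηh
  have main := cone_nonvanish (E := -(u ^ 3)⁻¹) (F := -u ^ 3) (R := R) (s := s) (C := C) (ε := ε)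
    hR0 hs0 (by field_simp) (by simp [hun]) (by simp [hs]) rfl rfl rfl
    (by
      refine le_trans ?_ (hε1.trans hηh)
      have : ε * K1 = ε * h⁻¹ + C * ((B * (ε * h⁻¹) + ε) * (h⁻¹) ^ 4) := by rw [hK1]; ring
      rw [this]
      gcongr)
    (by
      refine le_trans ?_ (hε2.trans hRη)
      have : ε * K2 = ε + C * (ε * h⁻¹ * (h⁻¹) ^ 2) := by rw [hK2]; ring
      rw [this]
      gcongr)
    n (fun k => y k / u ^ k) (fun k => - b k / u ^ 2) c hn
    (by intro k hk; simpa [hun] using hb k hk) hc hcC (by simpa using y0)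
    (by simp only [y1, hlu]; field_simp)
    (by simp only [y2, hlu]; field_simp; ring)
    (by
      intro k hk
      simp only [hy k hk, hlu]; field_simp; ring)
  intro k hk h0
  apply main k hk
  simp [h0]

theorem cone_uniform {κ B C : ℝ} (hκ : 0 < κ) (hB : 0 < B) (hC : 0 ≤ C) :
    ∃ ε > 0, ∀ lam : ℂ, ‖lam‖ ≤ B → κ ≤ |(lam ^ 3).im| → ∀ (n : ℕ) (y b : ℕ → ℂ) (c : ℕ → ℝ),
      1 ≤ n → (∀ k ≤ n, ‖b k‖ ≤ ε) → (∀ k ≤ n, 0 ≤ c k) → (∀ k ≤ n, c k ≤ C) → y 0 ≠ 0 →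
      y 1 = lam * y 0 → y 2 = lam * y 1 - b 1 * y 0 →
      (∀ k, k + 2 ≤ n → y (k + 3) = lam * y (k + 2) - b (k + 2) * y (k + 1) - c (k + 2) * y k) →
      ∀ k ≤ n + 1, y k ≠ 0 := by
  obtain ⟨ε, hε, H⟩ := cone_uniform_pos hκ hB hC
  refine ⟨ε, hε, ?_⟩
  intro lam hlam him n y b c hn hb hc hcC y0 y1 y2 hy
  rcases le_abs'.1 him with h | h
  · have := H (starRingEnd ℂ lam) (by simpa using hlam)
      (by rw [← map_pow, Complex.conj_im]; linarith) n (fun k => starRingEnd ℂ (y k))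
      (fun k => starRingEnd ℂ (b k)) c hn (by simpa using hb) hc hcC (by simpa using y0)
      (by simp [y1]) (by simp [y2]) (by
        intro k hk
        simp only [hy k hk, map_sub, map_mul, Complex.conj_ofReal])
    intro k hk h0
    exact this k hk (by simp [h0])
  · exact H lam hlam h n y b c hn hb hc hcC y0 y1 y2 hy

theorem large_nonvanish {C : ℝ} (hC : 0 ≤ C) (lam : ℂ) (hlam : C + 2 ≤ ‖lam‖) (n : ℕ) (y b : ℕ → ℂ)
    (c : ℕ → ℝ) (hn : 1 ≤ n) (hb : ∀ k ≤ n, ‖b k‖ ≤ 1) (hc : ∀ k ≤ n, 0 ≤ c k)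
    (hcC : ∀ k ≤ n, c k ≤ C) (y0 : y 0 ≠ 0)
    (y1 : y 1 = lam * y 0) (y2 : y 2 = lam * y 1 - b 1 * y 0)
    (hy : ∀ k, k + 2 ≤ n →
      y (k + 3) = lam * y (k + 2) - b (k + 2) * y (k + 1) - c (k + 2) * y k) :
    ∀ k ≤ n + 1, y k ≠ 0 := by
  have key : ∀ k, k + 1 ≤ n → 0 < ‖y k‖ ∧ ‖y k‖ ≤ ‖y (k + 1)‖ ∧ ‖y (k + 1)‖ ≤ ‖y (k + 2)‖ := by
    intro k
    induction k with
    | zero =>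
      intro hk
      have h0 : 0 < ‖y 0‖ := by simpa using y0
      have h1 : (C + 2) * ‖y 0‖ ≤ ‖y 1‖ := by rw [y1, norm_mul]; gcongr
      have h1' : ‖y 0‖ ≤ ‖y 1‖ := by nlinarith
      refine ⟨h0, h1', ?_⟩
      have h2 : ‖lam * y 1‖ - ‖b 1 * y 0‖ ≤ ‖y 2‖ := by rw [y2]; exact norm_sub_norm_le _ _
      rw [norm_mul, norm_mul] at h2
      have h3 : ‖b 1‖ * ‖y 0‖ ≤ 1 * ‖y 0‖ := by gcongr; exact hb 1 hn
      have h4 : (C + 2) * ‖y 1‖ ≤ ‖lam‖ * ‖y 1‖ := by gcongr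
      nlinarith
    | succ k ih =>
      intro hk
      obtain ⟨a0, a1, a2⟩ := ih (by omega)
      refine ⟨by linarith, a2, ?_⟩
      have h2 : ‖lam * y (k + 2)‖ - ‖b (k + 2) * y (k + 1)‖ - ‖(c (k + 2) : ℂ) * y k‖ ≤ ‖y (k + 3)‖ := by
        rw [hy k hk]
        have := norm_sub_norm_le (lam * y (k + 2) - b (k + 2) * y (k + 1)) (c (k + 2) * y k)
        have := norm_sub_norm_le (lam * y (k + 2)) (b (k + 2) * y (k + 1))
        linarith
      rw [norm_mul, norm_mul, norm_mul, Complex.norm_real, Real.norm_of_nonneg (hc _ hk)] at h2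
      have h3 : ‖b (k + 2)‖ * ‖y (k + 1)‖ ≤ 1 * ‖y (k + 1)‖ := by gcongr; exact hb _ hk
      have h4 : (C + 2) * ‖y (k + 2)‖ ≤ ‖lam‖ * ‖y (k + 2)‖ := by gcongr
      have h5 : c (k + 2) * ‖y k‖ ≤ C * ‖y k‖ := by gcongr; exact hcC _ hk
      show ‖y (k + 2)‖ ≤ ‖y (k + 3)‖
      nlinarith
  intro k hk
  obtain ⟨m, rfl⟩ : ∃ m, n = m + 1 := ⟨n - 1, by omega⟩
  have hk2 := key m le_rfl
  rcases Nat.lt_or_ge k (m + 1) with h | h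
  · exact norm_pos_iff.1 (key k h).1
  · rcases Nat.eq_or_lt_of_le h with h' | h'
    · rw [← h']; exact norm_pos_iff.1 (by linarith)
    · rw [show k = m + 2 by omega]; exact norm_pos_iff.1 (by linarith)
theorem Mmat_row (n : ℕ) (a : ℂ) (g : ℤ → ℂ) (h0 : g (-1) = 0) (h1 : g (n + 1) = 0)
    (h2 : g (n + 2) = 0) (i : Fin (n + 1)) :
    ∑ j : Fin (n + 1), Mmat n a i j * g ((j : ℕ) : ℤ) =
      ((i : ℕ) + 1 : ℂ) * a * g ((i : ℕ) + 1) + ((i : ℕ) + 1 : ℂ) * ((i : ℕ) + 2 : ℂ) * g ((i : ℕ) + 2)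
        + ((n : ℂ) - (i : ℕ) + 1) * g ((i : ℕ) - 1) := by
  obtain ⟨i, hi⟩ := i
  have e : ∀ j : Fin (n + 1), Mmat n a ⟨i, hi⟩ j * g ((j : ℕ) : ℤ) =
      (if (j : ℕ) = i + 1 then (i + 1 : ℂ) * a * g (i + 1) else 0) +
      (if (j : ℕ) = i + 2 then (i + 1 : ℂ) * (i + 2 : ℂ) * g (i + 2) else 0) +
      (if (j : ℕ) + 1 = i then ((n : ℂ) - i + 1) * g (i - 1) else 0) := by
    intro j
    obtain ⟨j, hj⟩ := j
    simp only [Mmat, Matrix.of_apply]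
    rcases eq_or_ne j (i + 1) with rfl | hj1
    · rw [if_pos rfl, if_pos rfl, if_neg (by omega), if_neg (by omega)]
      push_cast; ring
    · rw [if_neg hj1, if_neg hj1]
      rcases eq_or_ne j (i + 2) with rfl | hj2
      · rw [if_pos rfl, if_pos rfl, if_neg (by omega)]
        push_cast; ring
      · rw [if_neg hj2, if_neg hj2]
        rcases eq_or_ne i (j + 1) with rfl | hj3
        · rw [if_pos rfl, if_pos rfl]
          push_cast; ring_nf
        · rw [if_neg hj3, if_neg (by omega)]; ring
  rw [Finset.sum_congr rfl (fun j _ => e j), Finset.sum_add_distrib, Finset.sum_add_distrib]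
  congr 1
  · congr 1
    · rw [Fin.sum_univ_eq_sum_range (fun j => if j = i + 1 then (i + 1 : ℂ) * a * g (i + 1) else 0) (n + 1),
        Finset.sum_ite_eq']
      split_ifs with h
      · rfl
      · have : i = n := by simp at h; omega
        subst this
        rw [h1]; simp
    · rw [Fin.sum_univ_eq_sum_range (fun j => if j = i + 2 then (i + 1 : ℂ) * (i + 2 : ℂ) * g (i + 2) else 0) (n + 1),
        Finset.sum_ite_eq']
      split_ifs with h
      · rfl
      · have : i = n ∨ i + 1 = n := by simp at h; omega
        rcases this with rfl | rfl
        · rw [h2]; simp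
        · push_cast at h1
          rw [add_assoc] at h1
          norm_num at h1
          rw [h1]; simp
  · rw [Fin.sum_univ_eq_sum_range (fun j => if j + 1 = i then ((n : ℂ) - i + 1) * g (i - 1) else 0) (n + 1)]
    rcases i with _ | i
    · have h0' : g (((0 : ℕ) : ℤ) - 1) = 0 := by simpa using h0
      simp only [h0']; simp
    · simp only [Nat.add_right_cancel_iff]
      rw [Finset.sum_ite_eq', if_pos (by simp; omega)]

theorem SpPoly_roots (n : ℕ) (a : ℂ) : (SpPoly n a).roots = (Mmat n a).charpoly.roots := by
  have : SpPoly n a = (-1) ^ (n + 1) * (Mmat n a).charpoly := by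
    rw [SpPoly, ← neg_sub, Matrix.det_neg, Fintype.card_fin, Matrix.charpoly, Matrix.charmatrix]
    congr 3
    simp [Matrix.smul_one_eq_diagonal]
  rw [this]
  have h2 : ((-1) ^ (n + 1) : Polynomial ℂ) = Polynomial.C ((-1) ^ (n + 1)) := by simp
  rw [h2, Polynomial.roots_C_mul]
  exact pow_ne_zero _ (by norm_num)

theorem eigen_recurrence (n : ℕ) (hn : 1 ≤ n) (a z : ℂ) (σ : ℝ) (hσ : 0 < σ) (hσn : σ ^ 3 = n)
    (hz : z ∈ (SpPoly n a).roots) :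
    ∃ (y b : ℕ → ℂ) (c : ℕ → ℝ), (∀ k ≤ n, ‖b k‖ ≤ ‖a‖ / σ ^ 2) ∧ (∀ k ≤ n, 0 ≤ c k) ∧ (∀ k ≤ n, c k ≤ 1) ∧
      y 0 ≠ 0 ∧ y 1 = (z / σ ^ 4) * y 0 ∧ y 2 = (z / σ ^ 4) * y 1 - b 1 * y 0 ∧
      (∀ k, k + 2 ≤ n → y (k + 3) = (z / σ ^ 4) * y (k + 2) - b (k + 2) * y (k + 1) - c (k + 2) * y k) ∧
      y (n + 1) = 0 := by
  rw [SpPoly_roots] at hz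
  have hdet : (Matrix.scalar (Fin (n + 1)) z - Mmat n a).det = 0 := by
    rw [← Matrix.eval_charpoly]
    exact (Polynomial.mem_roots'.1 hz).2
  obtain ⟨v, hv0, hv⟩ := Matrix.exists_mulVec_eq_zero_iff.2 hdet
  have hσ0 : (σ : ℂ) ≠ 0 := by exact_mod_cast hσ.ne'
  obtain ⟨g, hg⟩ : ∃ g : ℤ → ℂ, g = fun j => if h : 0 ≤ j ∧ j.toNat < n + 1 then v ⟨j.toNat, h.2⟩ else 0 := ⟨_, rfl⟩
  have hgv : ∀ j : Fin (n + 1), g ((j : ℕ) : ℤ) = v j := by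
    intro j; rw [hg]; exact (dif_pos ⟨by omega, by have := j.2; omega⟩).trans (by congr 1)
  have hgneg : g (-1) = 0 := by rw [hg]; simp
  have hgn1 : g (n + 1) = 0 := by rw [hg]; exact dif_neg (by omega)
  have hgn2 : g (n + 2) = 0 := by rw [hg]; exact dif_neg (by omega)
  have hrow : ∀ i : ℕ, i ≤ n → (i + 1 : ℂ) * a * g (i + 1) + (i + 1 : ℂ) * (i + 2 : ℂ) * g (i + 2)
        + ((n : ℂ) - i + 1) * g (i - 1) = z * g i := by
    intro i hi
    have h1 := Mmat_row n a g hgneg hgn1 hgn2 ⟨i, by omega⟩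
    have h2 := congrFun hv ⟨i, by omega⟩
    rw [Matrix.sub_mulVec] at h2
    simp only [Pi.sub_apply, Pi.zero_apply, Matrix.mulVec, dotProduct] at h2
    simp only [hgv] at h1
    rw [h1, sub_eq_zero] at h2
    rw [← h2]
    have := hgv ⟨i, by omega⟩
    simp only at this
    rw [this]
    simp [Matrix.diagonal_apply]
  have hrec : ∀ k : ℕ, k ≤ n → (k + 1 : ℂ) * g ((n : ℤ) - k - 1) = z * g ((n : ℤ) - k)
      - ((n : ℂ) - k + 1) * a * g ((n : ℤ) - k + 1) - ((n : ℂ) - k + 1) * ((n : ℂ) - k + 2) * g ((n : ℤ) - k + 2) := by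
    intro k hk
    have := hrow (n - k) (by omega)
    push_cast [hk] at this
    linear_combination this
  have hgn : g n ≠ 0 := by
    intro h0
    apply hv0
    have : ∀ k : ℕ, k ≤ n → g ((n : ℤ) - k) = 0 ∧ g ((n : ℤ) - k + 1) = 0 ∧ g ((n : ℤ) - k + 2) = 0 := by
      intro k
      induction k with
      | zero => intro _; simpa using ⟨h0, hgn1, hgn2⟩
      | succ k ih =>
        intro hk
        obtain ⟨i0, i1, i2⟩ := ih (by omega)
        have h := hrec k (by omega)
        rw [i0, i1, i2] at h
        have hk1 : (k + 1 : ℂ) ≠ 0 := by exact_mod_cast Nat.succ_ne_zero k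
        push_cast
        refine ⟨?_, ?_, ?_⟩
        · rw [← sub_sub]
          simpa [hk1] using h
        · rw [← i0]; congr 1; ring
        · rw [← i1]; congr 1; ring
    funext j
    rw [← hgv j]
    have := (this (n - j) (by omega)).1
    have hj : (j : ℕ) ≤ n := by omega
    push_cast [hj] at this
    simpa using this
  have hn0 : (0 : ℝ) < n := by exact_mod_cast hn
  refine ⟨fun k => (k.factorial : ℂ) * g ((n : ℤ) - k) / (σ ^ 4) ^ k,
    fun k => ((n : ℂ) - k + 1) * k * a / σ ^ 8,
    fun k => ((n : ℝ) - k + 1) * ((n : ℝ) - k + 2) * k * ((k : ℝ) - 1) / σ ^ 12, ?_, ?_, ?_, ?_, ?_, ?_, ?_, ?_⟩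
  · intro k hk
    have hk' : (k : ℝ) ≤ n := by exact_mod_cast hk
    have e1 : ((n : ℂ) - k + 1) * k * a / σ ^ 8 = (((n : ℝ) - k + 1) * k / (n : ℝ) ^ 2 : ℝ) * (a / σ ^ 2) := by
      rw [← hσn]
      push_cast
      rw [show (n : ℂ) = ((σ ^ 3 : ℝ) : ℂ) by rw [hσn]; simp]
      push_cast
      field_simp
    have e2 : 0 ≤ ((n : ℝ) - k + 1) * k / (n : ℝ) ^ 2 := by
      apply div_nonneg _ (by positivity)
      apply mul_nonneg _ (by positivity)
      linarith
    have e3 : ((n : ℝ) - k + 1) * k / (n : ℝ) ^ 2 ≤ 1 := by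
      rw [div_le_one (by positivity)]
      rcases Nat.eq_zero_or_pos k with rfl | hk0
      · simp
      · have hk0' : (1 : ℝ) ≤ k := by exact_mod_cast hk0
        nlinarith
    show ‖((n : ℂ) - k + 1) * k * a / σ ^ 8‖ ≤ _
    rw [e1, norm_mul, Complex.norm_real, Real.norm_of_nonneg e2, norm_div, norm_pow, Complex.norm_real, Real.norm_of_nonneg hσ.le]
    exact mul_le_of_le_one_left (by positivity) e3
  · intro k hk
    have hk' : (k : ℝ) ≤ n := by exact_mod_cast hk
    apply div_nonneg _ (by positivity)
    rcases Nat.eq_zero_or_pos k with rfl | hk0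
    · simp
    · have hk0' : (1 : ℝ) ≤ k := by exact_mod_cast hk0
      apply mul_nonneg (mul_nonneg (mul_nonneg _ _) _) <;> linarith
  · intro k hk
    have hk' : (k : ℝ) ≤ n := by exact_mod_cast hk
    have e : σ ^ 12 = (n : ℝ) ^ 4 := by rw [← hσn]; ring
    rw [e, div_le_one (by positivity)]
    rcases Nat.lt_or_ge k 2 with hk0 | hk0
    · interval_cases k <;> simp
    · have hk0' : (2 : ℝ) ≤ k := by exact_mod_cast hk0
      calc ((n : ℝ) - k + 1) * ((n : ℝ) - k + 2) * k * ((k : ℝ) - 1) ≤ n * n * n * n := by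
            have a1 : (n : ℝ) - k + 1 ≤ n := by linarith
            have a2 : (n : ℝ) - k + 2 ≤ n := by linarith
            have a3 : (k : ℝ) - 1 ≤ n := by linarith
            have b1 : 0 ≤ (n : ℝ) - k + 1 := by linarith
            have b2 : 0 ≤ (n : ℝ) - k + 2 := by linarith
            have b3 : 0 ≤ (k : ℝ) - 1 := by linarith
            gcongr
        _ = _ := by ring
  · simpa using hgn
  · have := hrec 0 (by omega)
    simp only [Nat.cast_zero, sub_zero, hgn1, hgn2, zero_add, one_mul, mul_zero] at this
    simp [this]; ring
  · have h := hrec 1 hn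
    have h2 : g ((n : ℤ) - 1 + 2) = 0 := by rw [← hgn1]; congr 1; ring
    have h3 : g ((n : ℤ) - 1 + 1) = g n := by congr 1; ring
    simp only [Nat.cast_one, h2, h3] at h
    have h4 : g ((n : ℤ) - (2 : ℕ)) = g ((n : ℤ) - 1 - 1) := by congr 1; push_cast; ring
    simp only [h4, Nat.factorial, Nat.cast_one, Nat.cast_zero, sub_zero]
    push_cast
    field_simp
    linear_combination h
  · intro k hk
    have h := hrec (k + 2) hk
    have h1 : g ((n : ℤ) - (k + 3 : ℕ)) = g ((n : ℤ) - (k + 2 : ℕ) - 1) := by congr 1; push_cast; ring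
    have h2 : g ((n : ℤ) - (k + 1 : ℕ)) = g ((n : ℤ) - (k + 2 : ℕ) + 1) := by congr 1; push_cast; ring
    have h3 : g ((n : ℤ) - (k : ℕ)) = g ((n : ℤ) - (k + 2 : ℕ) + 2) := by congr 1; push_cast; ring
    simp only [h1, h2, h3, Nat.factorial_succ]
    push_cast at h ⊢
    rw [show (σ : ℂ) ^ 12 = (σ ^ 4) ^ 3 by ring, show (σ : ℂ) ^ 8 = (σ ^ 4) ^ 2 by ring]
    have hτ : (σ : ℂ) ^ 4 ≠ 0 := pow_ne_zero _ hσ0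
    generalize (σ : ℂ) ^ 4 = τ at hτ ⊢
    linear_combination (norm := skip) (((k : ℂ) + 2) * (k + 1) * k.factorial / τ ^ (k + 3)) * h
    field_simp
    ring
  · have : g ((n : ℤ) - (n + 1 : ℕ)) = 0 := by
      rw [← hgneg]; congr 1; push_cast; ring
    simp only [this]; simp

/-- Rescaled weights of walks of length `k` from `i` to `i + d`. -/
noncomputable def xw (n : ℕ) (a : ℂ) (σ : ℝ) : ℕ → ℤ → ℤ → ℂ
  | 0, _, d => if d = 0 then 1 else 0
  | k + 1, i, d =>
      ((i : ℂ) + 1) * a / (σ : ℂ) ^ 5 * xw n a σ k (i + 1) (d - 1)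
        + ((i : ℂ) + 1) * ((i : ℂ) + 2) / (σ : ℂ) ^ 6 * xw n a σ k (i + 2) (d - 2)
        + ((n : ℂ) - i + 1) / (σ : ℂ) ^ 3 * xw n a σ k (i - 1) (d + 1)

theorem xw_vanish_left (n : ℕ) (a : ℂ) (σ : ℝ) (k : ℕ) : ∀ i d : ℤ, i < 0 → 0 ≤ i + d →
    xw n a σ k i d = 0 := by
  induction k with
  | zero => intro i d h1 h2; simp only [xw]; rw [if_neg (by omega)]
  | succ k ih =>
    intro i d h1 h2
    simp only [xw]
    rw [ih (i - 1) (d + 1) (by omega) (by omega)]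
    by_cases h : i = -1
    · subst h; simp
    · rw [ih (i + 1) (d - 1) (by omega) (by omega)]
      by_cases h' : i = -2
      · subst h'; simp
      · rw [ih (i + 2) (d - 2) (by omega) (by omega)]; simp

theorem xw_vanish_right (n : ℕ) (a : ℂ) (σ : ℝ) (k : ℕ) : ∀ i d : ℤ, (n : ℤ) < i → i + d ≤ n →
    xw n a σ k i d = 0 := by
  induction k with
  | zero => intro i d h1 h2; simp only [xw]; rw [if_neg (by omega)]
  | succ k ih =>
    intro i d h1 h2
    simp only [xw]
    rw [ih (i + 1) (d - 1) (by omega) (by omega), ih (i + 2) (d - 2) (by omega) (by omega)]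
    by_cases h : i = n + 1
    · subst h; simp
    · rw [ih (i - 1) (d + 1) (by omega) (by omega)]; simp

theorem Mmat_pow (n : ℕ) (a : ℂ) (σ : ℝ) (hσ : 0 < σ) (k : ℕ) : ∀ i j : Fin (n + 1),
    (Mmat n a ^ k) i j
      = (σ : ℂ) ^ (4 * (k : ℤ) + (((j : ℕ) : ℤ) - ((i : ℕ) : ℤ)))
        * xw n a σ k ((i : ℕ) : ℤ) (((j : ℕ) : ℤ) - ((i : ℕ) : ℤ)) := by
  have hσ0 : (σ : ℂ) ≠ 0 := by exact_mod_cast hσ.ne'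
  induction k with
  | zero =>
    intro i j
    simp only [pow_zero, Matrix.one_apply, xw]
    by_cases h : i = j
    · subst h; simp
    · have : ((j : ℕ) : ℤ) - ((i : ℕ) : ℤ) ≠ 0 := by
        intro h'; apply h; ext; omega
      simp [h, this]
  | succ k ih =>
    intro i j
    rw [pow_succ', Matrix.mul_apply]
    have hj := j.2
    have := Mmat_row n a (fun l => (σ : ℂ) ^ (4 * (k : ℤ) + (((j : ℕ) : ℤ) - l))
        * xw n a σ k l (((j : ℕ) : ℤ) - l))
      (by rw [xw_vanish_left _ _ _ _ _ _ (by omega) (by omega)]; simp)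
      (by rw [xw_vanish_right _ _ _ _ _ _ (by omega) (by omega)]; simp)
      (by rw [xw_vanish_right _ _ _ _ _ _ (by omega) (by omega)]; simp) i
    simp only [← ih] at this
    simp only [ih] at this ⊢
    rw [this]
    simp only [xw]
    have e1 : ((j : ℕ) : ℤ) - (((i : ℕ) : ℤ) + 1) = ((j : ℕ) : ℤ) - ((i : ℕ) : ℤ) - 1 := by ring
    have e2 : ((j : ℕ) : ℤ) - (((i : ℕ) : ℤ) + 2) = ((j : ℕ) : ℤ) - ((i : ℕ) : ℤ) - 2 := by ring
    have e3 : ((j : ℕ) : ℤ) - (((i : ℕ) : ℤ) - 1) = ((j : ℕ) : ℤ) - ((i : ℕ) : ℤ) + 1 := by ring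
    rw [e1, e2, e3]
    generalize ((j : ℕ) : ℤ) - ((i : ℕ) : ℤ) = d
    have p0 : (σ : ℂ) ^ (4 * ((k + 1 : ℕ) : ℤ) + d) = (σ : ℂ) ^ (4 * (k : ℤ) + d) * (σ : ℂ) ^ 4 := by
      rw [← zpow_natCast, ← zpow_add₀ hσ0]; congr 1; push_cast; ring
    have p1 : (σ : ℂ) ^ (4 * (k : ℤ) + (d - 1)) = (σ : ℂ) ^ (4 * (k : ℤ) + d) / (σ : ℂ) := by
      rw [div_eq_mul_inv, ← zpow_sub_one₀ hσ0]; congr 1; ring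
    have p2 : (σ : ℂ) ^ (4 * (k : ℤ) + (d - 2)) = (σ : ℂ) ^ (4 * (k : ℤ) + d) / (σ : ℂ) ^ 2 := by
      rw [← zpow_natCast, ← zpow_sub₀ hσ0]; congr 1; push_cast; ring
    have p3 : (σ : ℂ) ^ (4 * (k : ℤ) + (d + 1)) = (σ : ℂ) ^ (4 * (k : ℤ) + d) * (σ : ℂ) := by
      rw [← zpow_add_one₀ hσ0]; congr 1; ring
    rw [p0, p1, p2, p3]
    push_cast
    field_simp

theorem trace_xw (n : ℕ) (a : ℂ) (σ : ℝ) (hσ : 0 < σ) (k : ℕ) :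
    (((SpPoly n a).roots.map (fun z => z / (σ : ℂ) ^ 4)).map (fun z => z ^ k)).sum
      = ∑ i ∈ Finset.range (n + 1), xw n a σ k (i : ℤ) 0 := by
  have hσ0 : (σ : ℂ) ≠ 0 := by exact_mod_cast hσ.ne'
  rw [Multiset.map_map, SpPoly_roots]
  have h1 : ((fun z : ℂ => z ^ k) ∘ fun z => z / (σ : ℂ) ^ 4)
      = fun z : ℂ => ((σ : ℂ) ^ 4)⁻¹ ^ k * z ^ k := by
    funext z; simp [div_eq_mul_inv, mul_pow, mul_comm]
  rw [h1, Multiset.sum_map_mul_left, ← trace_pow_eq, Matrix.trace, Finset.mul_sum,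
    ← Fin.sum_univ_eq_sum_range (fun i : ℕ => xw n a σ k (i : ℤ) 0)]
  refine Finset.sum_congr rfl fun i _ => ?_
  rw [Matrix.diag_apply, Mmat_pow n a σ hσ]
  simp only [sub_self, add_zero]
  rw [← mul_assoc]
  have : ((σ : ℂ) ^ 4)⁻¹ ^ k * (σ : ℂ) ^ (4 * (k : ℤ)) = 1 := by
    rw [zpow_mul, zpow_natCast, ← mul_pow]
    have : ((σ : ℂ) ^ 4)⁻¹ * (σ : ℂ) ^ (4 : ℤ) = 1 := by
      rw [show (4 : ℤ) = ((4 : ℕ) : ℤ) by norm_num, zpow_natCast]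
      exact inv_mul_cancel₀ (pow_ne_zero _ hσ0)
    rw [this, one_pow]
  rw [this, one_mul]

/-- Limits of the rescaled walk weights. -/
noncomputable def Wl : ℕ → ℤ → ℝ → ℝ
  | 0, d, _ => if d = 0 then 1 else 0
  | k + 1, d, t => t ^ 2 * Wl k (d - 2) t + (1 - t) * Wl k (d + 1) t

theorem xw_coef (n : ℕ) (hn : 1 ≤ n) (a : ℂ) (σ : ℝ) (h3 : σ ^ 3 = n) (k : ℕ)
    (i d : ℤ) : xw n a σ (k + 1) i d =
      ((i : ℂ) / n + 1 / n) * (a / (σ : ℂ) ^ 2) * xw n a σ k (i + 1) (d - 1)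
        + ((i : ℂ) / n + 1 / n) * ((i : ℂ) / n + 2 / n) * xw n a σ k (i + 2) (d - 2)
        + (1 - (i : ℂ) / n + 1 / n) * xw n a σ k (i - 1) (d + 1) := by
  have hn0 : (n : ℂ) ≠ 0 := by exact_mod_cast (by omega : n ≠ 0)
  have h3' : (n : ℂ) = (σ : ℂ) ^ 3 := by exact_mod_cast h3.symm
  have hσ0 : (σ : ℂ) ≠ 0 := by
    intro h; rw [h] at h3'; apply hn0; rw [h3']; simp
  simp only [xw]
  rw [h3']
  field_simp

theorem xw_tendsto (σ : ℕ → ℝ) (a : ℕ → ℂ) (h3 : ∀ n, σ n ^ 3 = n)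
    (ha : Tendsto (fun n => a n / (σ n : ℂ) ^ 2) atTop (nhds 0)) (k : ℕ) :
    ∀ (i : ℕ → ℤ) (d : ℤ) (t : ℝ), Tendsto (fun n => (i n : ℂ) / (n : ℂ)) atTop (nhds (t : ℂ)) →
      Tendsto (fun n => xw n (a n) (σ n) k (i n) d) atTop (nhds ((Wl k d t : ℝ) : ℂ)) := by
  have h1n : Tendsto (fun n : ℕ => 1 / (n : ℂ)) atTop (nhds 0) :=
    tendsto_one_div_atTop_nhds_zero_nat
  have h2n : Tendsto (fun n : ℕ => 2 / (n : ℂ)) atTop (nhds 0) := by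
    have := h1n.const_mul 2
    simpa [div_eq_mul_inv] using this
  induction k with
  | zero =>
    intro i d t hi
    simp only [xw, Wl]
    split_ifs <;> simp
  | succ k ih =>
    intro i d t hi
    have e : ∀ᶠ n in atTop, xw n (a n) (σ n) (k + 1) (i n) d = _ :=
      (eventually_ge_atTop 1).mono fun n hn => xw_coef n hn (a n) (σ n) (h3 n) k (i n) d
    refine Tendsto.congr' (e.mono fun _ h => h.symm) ?_
    have i1 : Tendsto (fun n => ((i n + 1 : ℤ) : ℂ) / (n : ℂ)) atTop (nhds (t : ℂ)) := by
      have := hi.add h1n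
      simpa [add_div] using this
    have i2 : Tendsto (fun n => ((i n + 2 : ℤ) : ℂ) / (n : ℂ)) atTop (nhds (t : ℂ)) := by
      have := hi.add h2n
      simpa [add_div] using this
    have i3 : Tendsto (fun n => ((i n - 1 : ℤ) : ℂ) / (n : ℂ)) atTop (nhds (t : ℂ)) := by
      have := hi.sub h1n
      simpa [sub_div] using this
    have := ((((hi.add h1n).mul ha).mul (ih _ (d - 1) t i1)).add
      (((hi.add h1n).mul (hi.add h2n)).mul (ih _ (d - 2) t i2))).add
      (((hi.const_sub 1).add h1n).mul (ih _ (d + 1) t i3))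
    refine this.trans (le_of_eq ?_)
    congr 1
    simp only [Wl]
    push_cast
    ring

theorem xw_bound (σ : ℕ → ℝ) (a : ℕ → ℂ) (h3 : ∀ n, σ n ^ 3 = n) (D : ℝ) (hD : 0 ≤ D)
    (ha : ∀ n, ‖a n / (σ n : ℂ) ^ 2‖ ≤ D) (k : ℕ) :
    ∀ A : ℝ, 0 ≤ A → ∃ C : ℝ, 0 ≤ C ∧ ∀ n : ℕ, 1 ≤ n → ∀ i : ℤ, |(i : ℝ)| ≤ A * n → ∀ d : ℤ,
      ‖xw n (a n) (σ n) k i d‖ ≤ C := by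
  induction k with
  | zero =>
    intro A hA
    refine ⟨1, zero_le_one, fun n hn i hi d => ?_⟩
    simp only [xw]
    split_ifs <;> simp
  | succ k ih =>
    intro A hA
    obtain ⟨C, hC, h⟩ := ih (A + 2) (by positivity)
    refine ⟨(A + 1) * D * C + (A + 1) * (A + 2) * C + (1 + A + 1) * C, by positivity,
      fun n hn i hi d => ?_⟩
    have hn1 : (1 : ℝ) ≤ n := by exact_mod_cast hn
    rw [xw_coef n hn (a n) (σ n) (h3 n)]
    have b1 : ‖(1 : ℂ) / n‖ ≤ 1 := by
      rw [norm_div, norm_one, Complex.norm_natCast, div_le_one (by linarith)]; exact hn1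
    have b2 : ‖(2 : ℂ) / n‖ ≤ 2 := by
      rw [norm_div, Complex.norm_ofNat, Complex.norm_natCast, div_le_iff₀ (by linarith)]; linarith
    have bi : ‖(i : ℂ) / n‖ ≤ A := by
      rw [norm_div, Complex.norm_intCast, Complex.norm_natCast, div_le_iff₀ (by linarith)]
      exact hi
    have hA' := abs_le.1 hi
    have c1 : ‖(i : ℂ) / n + 1 / n‖ ≤ A + 1 := (norm_add_le _ _).trans (add_le_add bi b1)
    have c2 : ‖(i : ℂ) / n + 2 / n‖ ≤ A + 2 := (norm_add_le _ _).trans (add_le_add bi b2)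
    have c3 : ‖1 - (i : ℂ) / n + 1 / n‖ ≤ 1 + A + 1 := by
      refine (norm_add_le _ _).trans (add_le_add ((norm_sub_le _ _).trans ?_) b1)
      rw [norm_one]; linarith
    have j1 := h n hn (i + 1) (by push_cast; rw [abs_le]; constructor <;> nlinarith) (d - 1)
    have j2 := h n hn (i + 2) (by push_cast; rw [abs_le]; constructor <;> nlinarith) (d - 2)
    have j3 := h n hn (i - 1) (by push_cast; rw [abs_le]; constructor <;> nlinarith) (d + 1)
    refine (norm_add₃_le).trans ?_
    simp only [norm_mul]
    have := ha n
    gcongr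

theorem integral_floor (f : ℕ → ℂ) (N : ℕ) :
    IntervalIntegrable (fun s : ℝ => f ⌊s⌋₊) volume 0 N ∧
    ∫ s in (0 : ℝ)..N, f ⌊s⌋₊ = ∑ i ∈ Finset.range N, f i := by
  have key : ∀ i : ℕ, IntervalIntegrable (fun s : ℝ => f ⌊s⌋₊) volume i ((i + 1 : ℕ) : ℝ) ∧
      ∫ s in (i : ℝ)..((i + 1 : ℕ) : ℝ), f ⌊s⌋₊ = f i := by
    intro i
    have hle : (i : ℝ) ≤ ((i + 1 : ℕ) : ℝ) := by push_cast; linarith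
    have hE : Set.EqOn (fun s : ℝ => f ⌊s⌋₊) (fun _ => f i) (Set.Ioo (i : ℝ) ((i + 1 : ℕ) : ℝ)) := by
      intro s hs
      have : ⌊s⌋₊ = i := by
        rw [Nat.floor_eq_iff (le_trans (Nat.cast_nonneg _) hs.1.le)]
        have := hs.2; push_cast at this
        exact ⟨hs.1.le, this⟩
      simp only [this]
    constructor
    · refine IntervalIntegrable.congr_uIoo (f := fun _ => f i) intervalIntegrable_const ?_
      rw [Set.uIoo_of_le hle]; exact hE.symm
    · rw [intervalIntegral.integral_congr_Ioo_of_le hle hE]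
      simp
  constructor
  · have := IntervalIntegrable.trans_iterate (μ := volume) (f := fun s : ℝ => f ⌊s⌋₊) (a := fun k : ℕ => (k : ℝ))
      (n := N) (fun k _ => (key k).1)
    simpa using this
  · have := intervalIntegral.sum_integral_adjacent_intervals (μ := volume) (f := fun s : ℝ => f ⌊s⌋₊)
      (a := fun k : ℕ => (k : ℝ)) (n := N) (fun k _ => (key k).1)
    simp only [Nat.cast_zero] at this
    rw [← this]
    exact Finset.sum_congr rfl fun i _ => (key i).2

theorem average_tendsto (X : ℕ → ℕ → ℂ) (W : ℝ → ℂ) (C : ℝ)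
    (hC : ∀ n, 1 ≤ n → ∀ i, i ≤ n + 1 → ‖X n i‖ ≤ C)
    (hW : ∀ (i : ℕ → ℕ) (t : ℝ), Tendsto (fun n => (i n : ℝ) / (n : ℝ)) atTop (nhds t) →
      Tendsto (fun n => X n (i n)) atTop (nhds (W t))) :
    Tendsto (fun n : ℕ => ((n : ℂ) + 1)⁻¹ * ∑ i ∈ Finset.range (n + 1), X n i) atTop
      (nhds (∫ t in (0 : ℝ)..1, W t)) := by
  have e : ∀ n : ℕ, ((n : ℂ) + 1)⁻¹ * ∑ i ∈ Finset.range (n + 1), X n i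
      = ∫ t in (0 : ℝ)..1, X n ⌊((n : ℝ) + 1) * t⌋₊ := by
    intro n
    have hne : ((n : ℝ) + 1) ≠ 0 := by positivity
    rw [intervalIntegral.integral_comp_mul_left (fun s => X n ⌊s⌋₊) hne]
    have := (integral_floor (X n) (n + 1)).2
    push_cast at this
    rw [mul_zero, mul_one, this, Complex.real_smul]
    push_cast; rfl
  simp only [e]
  refine intervalIntegral.tendsto_integral_filter_of_dominated_convergence (fun _ => C) ?_ ?_ ?_ ?_
  · refine Eventually.of_forall fun n => ?_
    refine Measurable.aestronglyMeasurable ?_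
    exact (measurable_from_nat (f := X n)).comp (Nat.measurable_floor.comp (measurable_const_mul _))
  · filter_upwards [eventually_ge_atTop 1] with n hn
    refine Eventually.of_forall fun t ht => ?_
    rw [Set.uIoc_of_le zero_le_one] at ht
    refine hC n hn _ ?_
    apply Nat.floor_le_of_le
    push_cast
    have : (0:ℝ) ≤ (n : ℝ) + 1 := by positivity
    nlinarith [ht.2]
  · exact intervalIntegrable_const
  · refine Eventually.of_forall fun t ht => ?_
    rw [Set.uIoc_of_le zero_le_one] at ht
    apply hW
    have h1 := (tendsto_nat_floor_mul_div_atTop (R := ℝ) ht.1.le).comp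
      (tendsto_atTop_add_const_right atTop (1 : ℝ) (tendsto_natCast_atTop_atTop (R := ℝ)))
    have h2 : Tendsto (fun n : ℕ => ((n : ℝ) + 1) / (n : ℝ)) atTop (nhds 1) := by
      have : Tendsto (fun n : ℕ => 1 + 1 / (n : ℝ)) atTop (nhds (1 + 0)) :=
        tendsto_const_nhds.add tendsto_one_div_atTop_nhds_zero_nat
      rw [add_zero] at this
      refine this.congr' ?_
      filter_upwards [eventually_ge_atTop 1] with n hn
      have : (n : ℝ) ≠ 0 := by exact_mod_cast (by omega : n ≠ 0)
      field_simp
    have h3 := h1.mul h2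
    rw [mul_one] at h3
    refine h3.congr' ?_
    filter_upwards [eventually_ge_atTop 1] with n hn
    have : (n : ℝ) ≠ 0 := by exact_mod_cast (by omega : n ≠ 0)
    have : (n : ℝ) + 1 ≠ 0 := by positivity
    simp only [Function.comp, mul_comm t]
    field_simp

theorem Wl_zero_of_not_dvd (t : ℝ) (k : ℕ) : ∀ d : ℤ, ¬ (3 : ℤ) ∣ d + k → Wl k d t = 0 := by
  induction k with
  | zero =>
    intro d hd
    simp only [Wl]
    rw [if_neg]
    rintro rfl
    simp at hd
  | succ k ih =>
    intro d hd
    simp only [Wl]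
    push_cast at hd
    rw [ih (d - 2) (by omega), ih (d + 1) (by omega)]
    ring

theorem Wl_neg (t : ℝ) (k : ℕ) : ∀ u : ℤ, u < 0 → Wl k (3 * u - k) t = 0 := by
  induction k with
  | zero =>
    intro u hu
    simp only [Wl]
    rw [if_neg (by push_cast; omega)]
  | succ k ih =>
    intro u hu
    simp only [Wl]
    rw [show 3 * u - ((k + 1 : ℕ) : ℤ) - 2 = 3 * (u - 1) - k by push_cast; ring,
      show 3 * u - ((k + 1 : ℕ) : ℤ) + 1 = 3 * u - k by push_cast; ring,
      ih _ (by omega), ih _ hu]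
    ring

theorem Wl_choose (t : ℝ) (k : ℕ) : ∀ u : ℕ, Wl k (3 * (u : ℤ) - k) t
    = (k.choose u : ℝ) * t ^ (2 * u) * (1 - t) ^ (k - u) := by
  induction k with
  | zero =>
    intro u
    simp only [Wl]
    rcases Nat.eq_zero_or_pos u with rfl | hu
    · simp
    · rw [if_neg (by push_cast; omega), Nat.choose_eq_zero_of_lt hu]; simp
  | succ k ih =>
    intro u
    simp only [Wl]
    rw [show 3 * (u : ℤ) - ((k + 1 : ℕ) : ℤ) + 1 = 3 * u - k by push_cast; ring, ih]
    rcases u with _ | u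
    · rw [show 3 * ((0 : ℕ) : ℤ) - ((k + 1 : ℕ) : ℤ) - 2 = 3 * (-1) - k by push_cast; ring,
        Wl_neg _ _ _ (by norm_num)]
      simp [pow_succ']
    · rw [show 3 * ((u + 1 : ℕ) : ℤ) - ((k + 1 : ℕ) : ℤ) - 2 = 3 * u - k by push_cast; ring, ih,
        Nat.choose_succ_succ, Nat.add_sub_add_right]
      by_cases h : u + 1 ≤ k
      · rw [show k - u = k - (u + 1) + 1 by omega]
        push_cast; ring
      · rw [Nat.choose_eq_zero_of_lt (show k < u + 1 by omega)]
        push_cast; ring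

/-- The limiting moments. -/
noncomputable def mom (k : ℕ) : ℝ := ∫ t in (0 : ℝ)..1, Wl k 0 t

theorem mom_not_dvd (k : ℕ) (h : ¬ 3 ∣ k) : mom k = 0 := by
  unfold mom
  rw [intervalIntegral.integral_congr (g := fun _ => 0)]
  · simp
  · intro t _
    exact Wl_zero_of_not_dvd t k 0 (by omega)

theorem mom_three (m : ℕ) : mom (3 * m) =
    ((3 * m).factorial * (2 * m).factorial : ℝ) / (m.factorial * (4 * m + 1).factorial) := by
  unfold mom
  have h1 : ∀ t : ℝ, Wl (3 * m) 0 t = ((3 * m).choose m : ℝ) * (t ^ (2 * m) * (1 - t) ^ (2 * m)) := by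
    intro t
    have := Wl_choose t (3 * m) m
    rw [show 3 * (m : ℤ) - ((3 * m : ℕ) : ℤ) = 0 by push_cast; ring, show 3 * m - m = 2 * m by omega] at this
    rw [this]; ring
  simp only [h1]
  rw [intervalIntegral.integral_const_mul]
  have h2 : ∫ t in (0 : ℝ)..1, t ^ (2 * m) * (1 - t) ^ (2 * m)
      = ((2 * m).factorial * (2 * m).factorial : ℝ) / (4 * m + 1).factorial := by
    have hb := Complex.Gamma_mul_Gamma_eq_betaIntegral (s := ((2 * m : ℕ) : ℂ) + 1)
      (t := ((2 * m : ℕ) : ℂ) + 1) (by simp; positivity) (by simp; positivity)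
    rw [Complex.Gamma_nat_eq_factorial,
      show ((2 * m : ℕ) : ℂ) + 1 + (((2 * m : ℕ) : ℂ) + 1) = ((4 * m + 1 : ℕ) : ℂ) + 1 by push_cast; ring,
      Complex.Gamma_nat_eq_factorial] at hb
    have hc : Complex.betaIntegral (((2 * m : ℕ) : ℂ) + 1) (((2 * m : ℕ) : ℂ) + 1)
        = ((∫ t in (0 : ℝ)..1, t ^ (2 * m) * (1 - t) ^ (2 * m) : ℝ) : ℂ) := by
      rw [Complex.betaIntegral, ← intervalIntegral.integral_ofReal]
      simp only [add_sub_cancel_right, Complex.cpow_natCast]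
      push_cast; rfl
    rw [hc] at hb
    have hb' : ((2 * m).factorial * (2 * m).factorial : ℝ)
      = (4 * m + 1).factorial * ∫ t in (0 : ℝ)..1, t ^ (2 * m) * (1 - t) ^ (2 * m) := by
      exact_mod_cast hb
    rw [hb']
    have : ((4 * m + 1).factorial : ℝ) ≠ 0 := by positivity
    field_simp
  rw [h2]
  have h3 := Nat.choose_mul_factorial_mul_factorial (show m ≤ 3 * m by omega)
  rw [show 3 * m - m = 2 * m by omega] at h3
  have h3' : ((3 * m).choose m : ℝ) * m.factorial * (2 * m).factorial = (3 * m).factorial := by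
    exact_mod_cast h3
  have : ((4 * m + 1).factorial : ℝ) ≠ 0 := by positivity
  have : ((m).factorial : ℝ) ≠ 0 := by positivity
  rw [← h3']
  field_simp

theorem moments_tendsto (σ : ℕ → ℝ) (a : ℕ → ℂ) (hσ : ∀ n, 1 ≤ n → 0 < σ n) (h3 : ∀ n, σ n ^ 3 = n)
    (ha : Tendsto (fun n => a n / (σ n : ℂ) ^ 2) atTop (nhds 0)) (k : ℕ) :
    Tendsto (fun n : ℕ => ((n : ℂ) + 1)⁻¹ *
      (((SpPoly n (a n)).roots.map (fun z => z / (σ n : ℂ) ^ 4)).map (fun z => z ^ k)).sum) atTop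
      (nhds ((mom k : ℝ) : ℂ)) := by
  obtain ⟨D, hD⟩ := (Metric.isBounded_range_of_tendsto _ ha).exists_norm_le
  have hD' : ∀ n, ‖a n / (σ n : ℂ) ^ 2‖ ≤ D := fun n => hD _ ⟨n, rfl⟩
  obtain ⟨C, hC, hb⟩ := xw_bound σ a h3 D ((norm_nonneg _).trans (hD' 0)) hD' k 2 (by norm_num)
  have := average_tendsto (fun n i => xw n (a n) (σ n) k (i : ℤ) 0) (fun t => ((Wl k 0 t : ℝ) : ℂ)) C
    (fun n hn i hi => hb n hn i (by
      have h1 : (i : ℝ) ≤ n + 1 := by exact_mod_cast hi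
      have h2 : (1 : ℝ) ≤ n := by exact_mod_cast hn
      push_cast
      rw [abs_of_nonneg (by positivity)]; linarith) 0)
    (fun i t hi => xw_tendsto σ a h3 ha k (fun n => (i n : ℤ)) 0 t (by
      have := (Complex.continuous_ofReal.tendsto t).comp hi
      refine this.congr fun n => ?_
      simp))
  rw [intervalIntegral.integral_ofReal] at this
  refine this.congr' ?_
  filter_upwards [eventually_ge_atTop 1] with n hn
  rw [trace_xw n (a n) (σ n) (hσ n hn)]

open ProbabilityTheory in
theorem beta_succ {α β : ℝ} (hα : 0 < α) (hβ : 0 < β) :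
    beta (α + 1) β = α / (α + β) * beta α β := by
  unfold beta
  rw [show α + 1 + β = (α + β) + 1 by ring, Real.Gamma_add_one hα.ne',
    Real.Gamma_add_one (add_pos hα hβ).ne']
  have := (Real.Gamma_pos_of_pos (add_pos hα hβ)).ne'
  have := (add_pos hα hβ).ne'
  field_simp

open ProbabilityTheory in
theorem integral_betaPDFReal {α β : ℝ} (hα : 0 < α) (hβ : 0 < β) : ∫ x, betaPDFReal α β x = 1 := by
  have h0 : ∀ x, 0 ≤ betaPDFReal α β x := by
    intro x
    by_cases hx : 0 < x ∧ x < 1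
    · exact (betaPDFReal_pos hx.1 hx.2 hα hβ).le
    · rw [betaPDFReal, if_neg hx]
  rw [integral_eq_lintegral_of_nonneg_ae (Eventually.of_forall h0) (by fun_prop)]
  have := lintegral_betaPDF_eq_one hα hβ
  unfold betaPDF at this
  rw [this]; simp

open ProbabilityTheory in
theorem beta_moment {α β : ℝ} (hα : 0 < α) (hβ : 0 < β) (m : ℕ) :
    ∫ x, x ^ m ∂(betaMeasure α β) = beta (α + m) β / beta α β := by
  unfold betaMeasure
  have hm : Measurable (betaPDF α β) := by unfold betaPDF; fun_prop
  rw [integral_withDensity_eq_integral_toReal_smul hm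
    (Eventually.of_forall fun x => by simp [betaPDF])]
  have h0 : ∀ x, 0 ≤ betaPDFReal α β x := by
    intro x
    by_cases hx : 0 < x ∧ x < 1
    · exact (betaPDFReal_pos hx.1 hx.2 hα hβ).le
    · rw [betaPDFReal, if_neg hx]
  have hαm : 0 < α + m := by positivity
  have e : ∀ x : ℝ, (betaPDF α β x).toReal • x ^ m
      = beta (α + m) β / beta α β * betaPDFReal (α + m) β x := by
    intro x
    rw [betaPDF, ENNReal.toReal_ofReal (h0 x), smul_eq_mul]
    unfold betaPDFReal
    split_ifs with hx
    · rw [show α + m - 1 = (α - 1) + m by ring, Real.rpow_add_natCast hx.1.ne']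
      have := (beta_pos hα hβ).ne'
      have := (beta_pos hαm hβ).ne'
      field_simp
    · simp
  simp only [e]
  rw [integral_const_mul, integral_betaPDFReal hαm hβ, mul_one]

open ProbabilityTheory in
theorem mom_eq_beta (m : ℕ) : mom (3 * m) = (27 / 64 : ℝ) ^ m *
    (beta (1 / 3 + m) (5 / 12) / beta (1 / 3) (5 / 12) *
      (beta (2 / 3 + m) (7 / 12) / beta (2 / 3) (7 / 12))) := by
  rw [mom_three]
  have b1 : beta (1 / 3) (5 / 12) ≠ 0 := (beta_pos (by norm_num) (by norm_num)).ne'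
  have b2 : beta (2 / 3) (7 / 12) ≠ 0 := (beta_pos (by norm_num) (by norm_num)).ne'
  induction m with
  | zero => simp; field_simp
  | succ m ih =>
    have e1 : beta (1 / 3 + ((m + 1 : ℕ) : ℝ)) (5 / 12)
        = (1 / 3 + m) / (1 / 3 + m + 5 / 12) * beta (1 / 3 + m) (5 / 12) := by
      rw [← beta_succ (by positivity) (by norm_num)]; push_cast; ring_nf
    have e2 : beta (2 / 3 + ((m + 1 : ℕ) : ℝ)) (7 / 12)
        = (2 / 3 + m) / (2 / 3 + m + 7 / 12) * beta (2 / 3 + m) (7 / 12) := by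
      rw [← beta_succ (by positivity) (by norm_num)]; push_cast; ring_nf
    rw [e1, e2]
    have : (27 / 64 : ℝ) ^ (m + 1) *
      ((1 / 3 + m) / (1 / 3 + m + 5 / 12) * beta (1 / 3 + m) (5 / 12) / beta (1 / 3) (5 / 12) *
      ((2 / 3 + m) / (2 / 3 + m + 7 / 12) * beta (2 / 3 + m) (7 / 12) / beta (2 / 3) (7 / 12)))
      = (27 / 64 * ((1 / 3 + m) / (1 / 3 + m + 5 / 12)) * ((2 / 3 + m) / (2 / 3 + m + 7 / 12))) *
      ((27 / 64 : ℝ) ^ m * (beta (1 / 3 + m) (5 / 12) / beta (1 / 3) (5 / 12) *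
      (beta (2 / 3 + m) (7 / 12) / beta (2 / 3) (7 / 12)))) := by
      rw [pow_succ]; ring
    rw [this, ← ih]
    rw [show 3 * (m + 1) = 3 * m + 1 + 1 + 1 by ring, show 2 * (m + 1) = 2 * m + 1 + 1 by ring,
      show 4 * (m + 1) + 1 = 4 * m + 1 + 1 + 1 + 1 + 1 by ring]
    simp only [Nat.factorial_succ (3 * m + 1 + 1), Nat.factorial_succ (3 * m + 1),
      Nat.factorial_succ (3 * m), Nat.factorial_succ (2 * m + 1), Nat.factorial_succ (2 * m),
      Nat.factorial_succ m, Nat.factorial_succ (4 * m + 1 + 1 + 1 + 1),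
      Nat.factorial_succ (4 * m + 1 + 1 + 1), Nat.factorial_succ (4 * m + 1 + 1),
      Nat.factorial_succ (4 * m + 1)]
    have f1 : ((3 * m).factorial : ℝ) ≠ 0 := by positivity
    have f2 : ((2 * m).factorial : ℝ) ≠ 0 := by positivity
    have f3 : ((m).factorial : ℝ) ≠ 0 := by positivity
    have f4 : ((4 * m + 1).factorial : ℝ) ≠ 0 := by positivity
    generalize (4 * m + 1).factorial = F4 at *
    generalize (3 * m).factorial = F3 at *
    generalize (2 * m).factorial = F2 at *
    generalize (m).factorial = F1 at *
    push_cast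
    have g1 : (1 / 3 + m + 5 / 12 : ℝ) ≠ 0 := by positivity
    have g2 : (2 / 3 + m + 7 / 12 : ℝ) ≠ 0 := by positivity
    field_simp
    ring

/-- Cube root parametrisation. -/
noncomputable def gcub (p : ℝ × ℝ) : ℝ := 3 / 4 * (p.1 * p.2) ^ ((1 : ℝ) / 3)

theorem gcub_cont : Continuous gcub := by
  unfold gcub
  exact continuous_const.mul ((continuous_fst.mul continuous_snd).rpow_const
    (fun _ => Or.inr (by norm_num)))

/-- The product of the two beta distributions. -/
noncomputable def bprod : Measure (ℝ × ℝ) :=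
  (ProbabilityTheory.betaMeasure (1 / 3) (5 / 12)).prod (ProbabilityTheory.betaMeasure (2 / 3) (7 / 12))

instance : IsProbabilityMeasure (ProbabilityTheory.betaMeasure (1 / 3) (5 / 12)) :=
  ProbabilityTheory.isProbabilityMeasureBeta (by norm_num) (by norm_num)

instance : IsProbabilityMeasure (ProbabilityTheory.betaMeasure (2 / 3) (7 / 12)) :=
  ProbabilityTheory.isProbabilityMeasureBeta (by norm_num) (by norm_num)

instance : IsProbabilityMeasure bprod := by unfold bprod; infer_instance

/-- Radial law. -/
noncomputable def rad : Measure ℝ := bprod.map gcub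

instance : IsProbabilityMeasure rad :=
  Measure.isProbabilityMeasure_map gcub_cont.measurable.aemeasurable

open ProbabilityTheory in
theorem beta_compl {α β : ℝ} : betaMeasure α β (Set.Ioo 0 1)ᶜ = 0 := by
  have hm : Measurable (betaPDF α β) := by unfold betaPDF; fun_prop
  unfold betaMeasure
  rw [withDensity_apply_eq_zero hm]
  convert measure_empty (μ := (volume : Measure ℝ))
  ext x
  simp only [Set.mem_inter_iff, Set.mem_compl_iff, Set.mem_Ioo, Set.mem_ofPred_eq,
    Set.mem_empty_iff_false, iff_false, not_and, betaPDF_eq]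
  intro h h'
  rw [if_neg (fun hh => h' hh.1 hh.2)] at h
  simp at h

open ProbabilityTheory in
theorem beta_open_pos {α β : ℝ} (hα : 0 < α) (hβ : 0 < β) (U : Set ℝ) (hU : IsOpen U)
    (hne : (U ∩ Set.Ioo 0 1).Nonempty) : betaMeasure α β U ≠ 0 := by
  have hm : Measurable (betaPDF α β) := by unfold betaPDF; fun_prop
  unfold betaMeasure
  rw [Ne, withDensity_apply_eq_zero hm]
  intro h
  have : volume (U ∩ Set.Ioo (0 : ℝ) 1) = 0 := by
    refine measure_mono_null ?_ h
    rintro x ⟨hx, hx'⟩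
    refine ⟨?_, hx⟩
    have := betaPDFReal_pos hx'.1 hx'.2 hα hβ
    simp only [betaPDF, Set.mem_ofPred_eq, ne_eq, ENNReal.ofReal_eq_zero, not_le]
    exact this
  exact ((hU.inter isOpen_Ioo).measure_pos volume hne).ne' this

theorem bprod_ae : ∀ᵐ p ∂bprod, p ∈ Set.Ioo (0 : ℝ) 1 ×ˢ Set.Ioo (0 : ℝ) 1 := by
  have hms : MeasurableSet (Set.Ioo (0 : ℝ) 1 ×ˢ Set.Ioo (0 : ℝ) 1) :=
    measurableSet_Ioo.prod measurableSet_Ioo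
  have : bprod (Set.Ioo (0 : ℝ) 1 ×ˢ Set.Ioo (0 : ℝ) 1) = 1 := by
    unfold bprod
    rw [Measure.prod_prod, (prob_compl_eq_zero_iff measurableSet_Ioo).1 beta_compl,
      (prob_compl_eq_zero_iff measurableSet_Ioo).1 beta_compl, one_mul]
  exact (prob_compl_eq_zero_iff hms).2 this

theorem rad_ae : ∀ᵐ r ∂rad, r ∈ Set.Icc (0 : ℝ) (3 / 4) := by
  unfold rad
  refine (ae_map_iff (p := fun r => r ∈ Set.Icc (0 : ℝ) (3 / 4)) gcub_cont.measurable.aemeasurable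
    measurableSet_Icc).2 ?_
  filter_upwards [bprod_ae] with p hp
  obtain ⟨⟨h1, h2⟩, h3, h4⟩ := hp
  unfold gcub
  have : (p.1 * p.2) ^ ((1 : ℝ) / 3) ≤ 1 :=
    Real.rpow_le_one (by positivity) (by nlinarith) (by norm_num)
  have h0 : 0 ≤ (p.1 * p.2) ^ ((1 : ℝ) / 3) := by positivity
  constructor <;> linarith

theorem rad_moment (m : ℕ) : ∫ r, r ^ (3 * m) ∂rad = mom (3 * m) := by
  unfold rad
  rw [integral_map gcub_cont.measurable.aemeasurable (by fun_prop), mom_eq_beta]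
  have : ∫ p, gcub p ^ (3 * m) ∂bprod = ∫ p : ℝ × ℝ, (27 / 64 : ℝ) ^ m * (p.1 ^ m * p.2 ^ m) ∂bprod := by
    refine integral_congr_ae ?_
    filter_upwards [bprod_ae] with p hp
    obtain ⟨⟨h1, h2⟩, h3, h4⟩ := hp
    rw [pow_mul, ← mul_pow, ← mul_pow]
    congr 1
    unfold gcub
    rw [mul_pow, ← Real.rpow_natCast ((p.1 * p.2) ^ ((1 : ℝ) / 3)), ← Real.rpow_mul (by positivity)]
    norm_num
  rw [this, integral_const_mul]
  unfold bprod
  rw [integral_prod_mul (fun x : ℝ => x ^ m) (fun x : ℝ => x ^ m),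
    beta_moment (by norm_num) (by norm_num), beta_moment (by norm_num) (by norm_num)]

theorem rad_open_pos (r : ℝ) (hr : r ∈ Set.Icc (0 : ℝ) (3 / 4)) (U : Set ℝ) (hU : IsOpen U)
    (hrU : r ∈ U) : rad U ≠ 0 := by
  unfold rad
  rw [Measure.map_apply gcub_cont.measurable hU.measurableSet]
  have hV : IsOpen (gcub ⁻¹' U) := hU.preimage gcub_cont
  have hmem : ((1 : ℝ), (4 / 3 * r) ^ 3) ∈ gcub ⁻¹' U := by
    have : gcub ((1 : ℝ), (4 / 3 * r) ^ 3) = r := by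
      unfold gcub
      have h0 : 0 ≤ 4 / 3 * r := by have := hr.1; positivity
      simp only [one_mul]
      rw [← Real.rpow_natCast, ← Real.rpow_mul h0]
      norm_num
      ring
    rw [Set.mem_preimage, this]; exact hrU
  have h0 : 0 ≤ 4 / 3 * r := by have := hr.1; positivity
  have h1 : 4 / 3 * r ≤ 1 := by have := hr.2; linarith
  obtain ⟨A, B, hA, hB, h1A, h1B, hAB⟩ := isOpen_prod_iff.1 hV _ _ hmem
  have cl : closure (Set.Ioo (0 : ℝ) 1) = Set.Icc 0 1 := closure_Ioo (by norm_num)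
  have nA : (A ∩ Set.Ioo (0 : ℝ) 1).Nonempty :=
    mem_closure_iff.1 (by rw [cl]; simp : (1 : ℝ) ∈ closure (Set.Ioo (0 : ℝ) 1)) A hA h1A
  have nB : (B ∩ Set.Ioo (0 : ℝ) 1).Nonempty :=
    mem_closure_iff.1 (by rw [cl]; exact ⟨by positivity, pow_le_one₀ h0 h1⟩ :
      (4 / 3 * r) ^ 3 ∈ closure (Set.Ioo (0 : ℝ) 1)) B hB h1B
  intro h
  have := measure_mono_null hAB h
  unfold bprod at this
  rw [Measure.prod_prod, mul_eq_zero] at this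
  rcases this with h | h
  · exact beta_open_pos (by norm_num) (by norm_num) A hA nA h
  · exact beta_open_pos (by norm_num) (by norm_num) B hB nB h

/-- Cube roots of unity. -/
noncomputable def om (j : ℕ) : ℂ := Complex.exp (2 * Real.pi * Complex.I * (j : ℂ) / 3)

theorem om_pow (j : ℕ) : om j = om 1 ^ j := by
  unfold om
  rw [← Complex.exp_nat_mul]
  congr 1
  push_cast; ring

theorem om_prim : IsPrimitiveRoot (om 1) 3 := by
  have := Complex.isPrimitiveRoot_exp 3 (by norm_num)
  unfold om
  convert this using 2
  push_cast; ring

theorem om_cube (j : ℕ) : om j ^ 3 = 1 := by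
  rw [om_pow, ← pow_mul, mul_comm, pow_mul, om_prim.pow_eq_one, one_pow]

theorem om_norm (j : ℕ) : ‖om j‖ = 1 :=
  Complex.norm_eq_one_of_pow_eq_one (om_cube j) (by norm_num)

theorem om_sum (k : ℕ) (hk : ¬ 3 ∣ k) : ∑ j ∈ Finset.range 3, om j ^ k = 0 := by
  have h : ∀ j, om j ^ k = (om 1 ^ k) ^ j := fun j => by
    rw [om_pow j, ← pow_mul, ← pow_mul, mul_comm]
  rw [Finset.sum_congr rfl fun j _ => h j]
  have hne : om 1 ^ k ≠ 1 := fun h => hk ((om_prim.pow_eq_one_iff_dvd k).1 h)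
  rw [geom_sum_eq hne, ← pow_mul, mul_comm, pow_mul, om_prim.pow_eq_one]
  simp

/-- The limit measure. -/
noncomputable def nu : Measure ℂ :=
  (3 : ℝ≥0∞)⁻¹ • ∑ j ∈ Finset.range 3, rad.map (fun r : ℝ => (r : ℂ) * om j)

theorem ray_cont (j : ℕ) : Continuous (fun r : ℝ => (r : ℂ) * om j) := by fun_prop

theorem ray_prob (j : ℕ) : IsProbabilityMeasure (rad.map (fun r : ℝ => (r : ℂ) * om j)) :=
  Measure.isProbabilityMeasure_map (ray_cont j).measurable.aemeasurable

theorem nu_prob : IsProbabilityMeasure nu := by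
  constructor
  unfold nu
  have := ray_prob
  rw [Measure.smul_apply, Measure.finsetSum_apply]
  simp only [measure_univ]
  simp
  exact ENNReal.inv_mul_cancel (by norm_num) (by norm_num)

/-- The star. -/
def star3 : Set ℂ := ⋃ j ∈ Finset.range 3, segment ℝ (0 : ℂ)
  ((3 / 4 : ℂ) * Complex.exp (2 * Real.pi * Complex.I * (j : ℂ) / 3))

theorem mem_star3 (z : ℂ) : z ∈ star3 ↔ ∃ j ∈ Finset.range 3, ∃ r ∈ Set.Icc (0 : ℝ) (3 / 4),
    z = (r : ℂ) * om j := by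
  unfold star3
  simp only [Set.mem_iUnion, segment_eq_image, Set.mem_image, exists_prop]
  refine exists_congr fun j => and_congr_right fun hj => ?_
  constructor
  · rintro ⟨t, ht, rfl⟩
    refine ⟨3 / 4 * t, ⟨by linarith [ht.1], by linarith [ht.2]⟩, ?_⟩
    simp [om]; ring
  · rintro ⟨r, hr, rfl⟩
    refine ⟨4 / 3 * r, ⟨by linarith [hr.1], by linarith [hr.2]⟩, ?_⟩
    simp [om]; ring

theorem star3_closed : IsClosed star3 := by
  have : star3 = ⋃ j ∈ Finset.range 3, (fun r : ℝ => (r : ℂ) * om j) '' Set.Icc (0 : ℝ) (3 / 4) := by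
    ext z
    rw [mem_star3]
    simp only [Set.mem_iUnion, Set.mem_image, exists_prop, eq_comm]
  rw [this]
  exact isClosed_biUnion_finset fun j _ => (isCompact_Icc.image (ray_cont j)).isClosed

theorem nu_ae (p : ℂ → Prop) (hp : ∀ z ∈ star3, p z) : ∀ᵐ z ∂nu, p z := by
  have : ∀ᵐ z ∂nu, z ∈ star3 := by
    unfold nu
    refine Measure.ae_smul_measure ?_ _
    rw [ae_finsetSum_measure_iff]
    intro j hj
    refine (ae_map_iff (p := fun z => z ∈ star3) (ray_cont j).measurable.aemeasurable
      star3_closed.measurableSet).2 ?_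
    filter_upwards [rad_ae] with r hr
    exact (mem_star3 _).2 ⟨j, hj, r, hr, rfl⟩
  exact this.mono hp

theorem nu_support (x : ℂ) : x ∈ star3 ↔ ∀ U ∈ nhds x, nu U ≠ 0 := by
  constructor
  · intro hx U hU
    obtain ⟨j, hj, r, hr, rfl⟩ := (mem_star3 x).1 hx
    obtain ⟨V, hVU, hV, hxV⟩ := mem_nhds_iff.1 hU
    intro h0
    have h1 := measure_mono_null hVU h0
    unfold nu at h1
    rw [Measure.smul_apply, Measure.finsetSum_apply, smul_eq_mul, mul_eq_zero] at h1
    rcases h1 with h1 | h1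
    · simp at h1
    · have h2 := (Finset.sum_eq_zero_iff.1 h1) j hj
      rw [Measure.map_apply (ray_cont j).measurable hV.measurableSet] at h2
      exact rad_open_pos r hr _ (hV.preimage (ray_cont j)) hxV h2
  · intro h
    by_contra hx
    exact h _ (star3_closed.isOpen_compl.mem_nhds hx) (nu_ae (fun z => z ∈ star3) fun z hz => hz)

theorem rad_integrable (h : ℝ → ℂ) (hc : Continuous h) : Integrable h rad := by
  have h1 : IntegrableOn h (Set.Icc (0 : ℝ) (3 / 4)) rad := hc.integrableOn_Icc
  unfold IntegrableOn at h1
  rwa [Measure.restrict_eq_self_of_ae_mem rad_ae] at h1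

theorem nu_moment (k : ℕ) : ∫ z, z ^ k ∂nu = ((mom k : ℝ) : ℂ) := by
  unfold nu
  rw [integral_smul_measure, integral_finsetSum_measure]
  · have e : ∀ j, ∫ z, z ^ k ∂(rad.map (fun r : ℝ => (r : ℂ) * om j))
        = (∫ r, ((r : ℂ)) ^ k ∂rad) * om j ^ k := by
      intro j
      rw [integral_map (ray_cont j).measurable.aemeasurable (by fun_prop)]
      simp only [mul_pow]
      rw [integral_mul_const]
    simp only [e, ← Finset.mul_sum]
    by_cases hk : 3 ∣ k
    · obtain ⟨m, rfl⟩ := hk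
      have : ∀ j, om j ^ (3 * m) = 1 := fun j => by rw [pow_mul, om_cube, one_pow]
      simp only [this]
      have e2 : ∫ r : ℝ, (r : ℂ) ^ (3 * m) ∂rad = ((∫ r : ℝ, r ^ (3 * m) ∂rad : ℝ) : ℂ) := by
        rw [← integral_complex_ofReal]; push_cast; rfl
      rw [e2, rad_moment]
      simp
      ring
    · rw [om_sum k hk, mom_not_dvd k hk]; simp
  · intro j _
    rw [integrable_map_measure (by fun_prop) (ray_cont j).measurable.aemeasurable]
    exact rad_integrable _ (by fun_prop)

/-- The compact set on which polynomials are dense. -/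
def Sset : Set ℂ := {z : ℂ | ‖z‖ ≤ 3 ∧ (z ^ 3).im = 0}

theorem mem_Sset (z : ℂ) : z ∈ Sset ↔ ‖z‖ ≤ 3 ∧ (z ^ 3).im = 0 := Iff.rfl

theorem Sset_compact : IsCompact Sset := by
  refine (isCompact_closedBall (0 : ℂ) 3).of_isClosed_subset ?_ ?_
  · exact (isClosed_le continuous_norm continuous_const).inter
      (isClosed_eq (Complex.continuous_im.comp (continuous_pow 3)) continuous_const)
  · intro z hz
    simpa using hz.1

theorem conj_approx (δ : ℝ) (hδ : 0 < δ) : ∃ P : Polynomial ℂ, ∀ z ∈ Sset,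
    ‖star z - P.eval z‖ ≤ 3 * δ := by
  have hcont : ContinuousOn (fun x : ℝ => (max x (δ ^ 6)) ^ (-(2 / 3) : ℝ)) (Set.Icc 0 (3 ^ 6)) := by
    refine Continuous.continuousOn ?_
    refine Continuous.rpow_const (by fun_prop) fun x => Or.inl ?_
    exact (lt_max_of_lt_right (by positivity)).ne'
  obtain ⟨q, hq⟩ := exists_polynomial_near_of_continuousOn 0 (3 ^ 6) _ hcont (δ / 3 ^ 5) (by positivity)
  refine ⟨Polynomial.X ^ 5 * (q.map Complex.ofRealHom).comp (Polynomial.X ^ 6), fun z hz => ?_⟩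
  obtain ⟨hz3, him⟩ := hz
  have h6 : z ^ 6 = ((‖z‖ ^ 6 : ℝ) : ℂ) := by
    have h1 : z ^ 3 = (((z ^ 3).re : ℝ) : ℂ) := by
      apply Complex.ext <;> simp [him]
    have h2 : ‖z‖ ^ 6 = ((z ^ 3).re) ^ 2 := by
      rw [← sq_abs (z ^ 3).re, ← Real.norm_eq_abs, ← Complex.norm_real, ← h1, norm_pow, ← pow_mul]
    rw [h2]
    push_cast
    rw [← h1, ← pow_mul]
  have he : (Polynomial.X ^ 5 * (q.map Complex.ofRealHom).comp (Polynomial.X ^ 6)).eval z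
      = z ^ 5 * ((q.eval (‖z‖ ^ 6) : ℝ) : ℂ) := by
    rw [Polynomial.eval_mul, Polynomial.eval_comp, Polynomial.eval_pow, Polynomial.eval_pow,
      Polynomial.eval_X, h6]
    congr 1
    exact Polynomial.eval_map_apply (f := Complex.ofRealHom) (p := q) (‖z‖ ^ 6)
  rw [he]
  set r := ‖z‖ with hr
  have hr0 : 0 ≤ r := norm_nonneg z
  have hqr := hq (r ^ 6) ⟨by positivity, pow_le_pow_left₀ hr0 hz3 6⟩
  set w : ℝ := (max (r ^ 6) (δ ^ 6)) ^ (-(2 / 3) : ℝ) with hw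
  have key : ‖star z - z ^ 5 * (w : ℂ)‖ ≤ 2 * δ := by
    by_cases hrd : δ ≤ r
    · have hrpos : 0 < r := hδ.trans_le hrd
      have hz0 : z ≠ 0 := norm_pos_iff.1 hrpos
      have hwv : w = (r ^ 4)⁻¹ := by
        rw [hw, max_eq_left (pow_le_pow_left₀ hδ.le hrd 6), Real.rpow_neg (by positivity),
          ← Real.rpow_natCast, ← Real.rpow_mul hr0, ← Real.rpow_natCast]
        norm_num
      have hzz : z * star z = ((r ^ 2 : ℝ) : ℂ) := by
        rw [Complex.star_def, Complex.mul_conj, Complex.normSq_eq_norm_sq]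
      have : star z = z ^ 5 * (w : ℂ) := by
        apply mul_left_cancel₀ hz0
        rw [hzz, ← mul_assoc, ← pow_succ', h6, hwv]
        norm_cast
        field_simp
      rw [this, sub_self, norm_zero]; positivity
    · push Not at hrd
      have hwv : w = (δ ^ 4)⁻¹ := by
        rw [hw, max_eq_right (pow_le_pow_left₀ hr0 hrd.le 6), Real.rpow_neg (by positivity),
          ← Real.rpow_natCast, ← Real.rpow_mul hδ.le, ← Real.rpow_natCast]
        norm_num
      refine (norm_sub_le _ _).trans ?_
      rw [norm_star, norm_mul, norm_pow, ← hr, hwv, Complex.norm_real, Real.norm_eq_abs,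
        abs_of_pos (by positivity)]
      have : r ^ 5 * (δ ^ 4)⁻¹ ≤ δ := by
        rw [← div_eq_mul_inv, div_le_iff₀ (by positivity)]
        calc r ^ 5 ≤ δ ^ 5 := pow_le_pow_left₀ hr0 hrd.le 5
          _ = δ * δ ^ 4 := by ring
      linarith
  have key2 : ‖z ^ 5 * (w : ℂ) - z ^ 5 * ((q.eval (r ^ 6) : ℝ) : ℂ)‖ ≤ δ := by
    rw [← mul_sub, norm_mul, norm_pow, ← hr, ← Complex.ofReal_sub, Complex.norm_real,
      Real.norm_eq_abs, abs_sub_comm]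
    calc r ^ 5 * |q.eval (r ^ 6) - w| ≤ 3 ^ 5 * (δ / 3 ^ 5) := by
          gcongr
      _ = δ := by ring
  calc _ = ‖(star z - z ^ 5 * (w : ℂ)) + (z ^ 5 * (w : ℂ) - z ^ 5 * ((q.eval (r ^ 6) : ℝ) : ℂ))‖ := by
        congr 1; ring
    _ ≤ 3 * δ := (norm_add_le _ _).trans (by linarith)

theorem poly_dense (f : ℂ → ℂ) (hf : Continuous f) (η : ℝ) (hη : 0 < η) :
    ∃ P : Polynomial ℂ, ∀ z ∈ Sset, ‖f z - P.eval z‖ < η := by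
  have : CompactSpace Sset := isCompact_iff_compactSpace.1 Sset_compact
  have htop : (polynomialFunctions Sset).topologicalClosure = ⊤ := by
    have hle : (polynomialFunctions Sset).starClosure.toSubalgebra
        ≤ (polynomialFunctions Sset).topologicalClosure := by
      rw [polynomialFunctions.starClosure_eq_adjoin_X, StarAlgebra.adjoin_toSubalgebra]
      refine Algebra.adjoin_le ?_
      rintro g (hg | hg)
      · rw [Set.mem_singleton_iff] at hg
        subst hg
        exact Subalgebra.le_topologicalClosure _ ⟨Polynomial.X, trivial, rfl⟩
      · rw [Set.mem_star, Set.mem_singleton_iff] at hg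
        rw [SetLike.mem_coe, ← SetLike.mem_coe, Subalgebra.topologicalClosure_coe, Metric.mem_closure_iff]
        intro ε hε
        obtain ⟨P, hP⟩ := conj_approx (ε / 6) (by positivity)
        refine ⟨Polynomial.toContinuousMapOnAlgHom Sset P, ⟨P, trivial, rfl⟩, ?_⟩
        rw [ContinuousMap.dist_lt_iff hε]
        intro z
        have hgz : g z = star (z : ℂ) := by
          have := congrArg (fun h : C(Sset, ℂ) => star (h z)) hg
          simpa using this
        have := hP z z.2
        rw [hgz, dist_eq_norm]
        refine lt_of_le_of_lt this (by linarith)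
    rw [eq_top_iff]
    intro g _
    have hg : g ∈ (polynomialFunctions Sset).starClosure.topologicalClosure := by
      rw [polynomialFunctions.starClosure_topologicalClosure]; trivial
    rw [← SetLike.mem_coe, StarSubalgebra.topologicalClosure_coe] at hg
    have h2 : closure ((polynomialFunctions Sset).starClosure : Set C(Sset, ℂ))
        ⊆ ((polynomialFunctions Sset).topologicalClosure : Set C(Sset, ℂ)) :=
      closure_minimal hle (Subalgebra.isClosed_topologicalClosure _)
    exact h2 hg
  have hmem : (⟨fun z => f z, by fun_prop⟩ : C(Sset, ℂ)) ∈ (polynomialFunctions Sset).topologicalClosure := by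
    rw [htop]; trivial
  rw [← SetLike.mem_coe, Subalgebra.topologicalClosure_coe, Metric.mem_closure_iff] at hmem
  obtain ⟨g, ⟨P, -, rfl⟩, hg⟩ := hmem η hη
  refine ⟨P, fun z hz => ?_⟩
  rw [ContinuousMap.dist_lt_iff hη] at hg
  have := hg ⟨z, hz⟩
  rw [dist_eq_norm] at this
  exact this

theorem dirac_sum (f : ℂ → ℝ) (s : Multiset ℂ) :
    Integrable f (s.map Measure.dirac).sum ∧ ∫ x, f x ∂(s.map Measure.dirac).sum = (s.map f).sum := by
  induction s using Multiset.induction_on with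
  | empty => simp
  | cons a s ih =>
    have h1 : Integrable f (Measure.dirac a) := integrable_dirac (by simp)
    simp only [Multiset.map_cons, Multiset.sum_cons]
    exact ⟨h1.add_measure ih.1, by rw [integral_add_measure h1 ih.1, ih.2, integral_dirac]⟩

theorem root_integral (n : ℕ) (a : ℂ) (f : ℂ → ℝ) : ∫ x, f x ∂(rootMeasure n a) =
    ((n : ℝ) + 1)⁻¹ * (((SpPoly n a).roots.map
      (fun z => z / (((n : ℝ) ^ ((4 : ℝ) / 3) : ℝ) : ℂ))).map f).sum := by
  unfold rootMeasure
  rw [integral_smul_measure, (dirac_sum f _).2, smul_eq_mul]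
  congr 1
  rw [ENNReal.toReal_inv, ENNReal.toReal_add (by simp) (by simp)]
  simp

theorem roots_card (n : ℕ) (a : ℂ) : (SpPoly n a).roots.card = n + 1 := by
  rw [SpPoly_roots, Polynomial.splits_iff_card_roots.1 (IsAlgClosed.splits _),
    Matrix.charpoly_natDegree_eq_dim, Fintype.card_fin]

theorem roots_location (σ : ℕ → ℝ) (a : ℕ → ℂ) (hσ : ∀ n, 1 ≤ n → 0 < σ n) (h3 : ∀ n, σ n ^ 3 = n)
    (ha : Tendsto (fun n => a n / (σ n : ℂ) ^ 2) atTop (nhds 0)) (κ : ℝ) (hκ : 0 < κ) :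
    ∀ᶠ n in atTop, ∀ z ∈ (SpPoly n (a n)).roots.map (fun z => z / (σ n : ℂ) ^ 4),
      ‖z‖ ≤ 3 ∧ |(z ^ 3).im| < κ := by
  obtain ⟨ε, hε, H⟩ := cone_uniform (κ := κ) (B := 3) (C := 1) hκ (by norm_num) (by norm_num)
  have h1 : ∀ᶠ n in atTop, ‖a n / (σ n : ℂ) ^ 2‖ < min ε 1 := by
    have := ha.norm
    rw [norm_zero] at this
    exact this.eventually_lt_const (by positivity)
  filter_upwards [h1, eventually_ge_atTop 1] with n hn hn1 w hw
  obtain ⟨z, hz, rfl⟩ := Multiset.mem_map.1 hw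
  obtain ⟨y, b, c, hb, hc, hc1, y0, y1, y2, hy, hend⟩ :=
    eigen_recurrence n hn1 (a n) z (σ n) (hσ n hn1) (h3 n) hz
  have hnn : ‖a n‖ / σ n ^ 2 < min ε 1 := by
    rw [norm_div, norm_pow, Complex.norm_real, Real.norm_eq_abs, abs_of_pos (hσ n hn1)] at hn
    exact hn
  have hle : ‖z / (σ n : ℂ) ^ 4‖ ≤ 3 := by
    by_contra hcon
    push Not at hcon
    exact large_nonvanish (C := 1) (by norm_num) _ (by linarith) n y b c hn1
      (fun k hk => (hb k hk).trans (hnn.le.trans (min_le_right _ _))) hc hc1 y0 y1 y2 hy (n + 1) le_rfl hend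
  refine ⟨hle, ?_⟩
  by_contra hcon
  push Not at hcon
  exact H _ hle hcon n y b c hn1
    (fun k hk => (hb k hk).trans (hnn.le.trans (min_le_left _ _))) hc hc1 y0 y1 y2 hy (n + 1) le_rfl hend

theorem nu_integrable (h : ℂ → ℂ) (hc : Continuous h) : Integrable h nu := by
  unfold nu
  refine Integrable.smul_measure ?_ (by simp)
  rw [integrable_finsetSum_measure]
  intro j _
  rw [integrable_map_measure hc.aestronglyMeasurable (ray_cont j).measurable.aemeasurable]
  exact rad_integrable _ (hc.comp (ray_cont j))

theorem poly_tendsto (σ : ℕ → ℝ) (a : ℕ → ℂ) (hσ : ∀ n, 1 ≤ n → 0 < σ n) (h3 : ∀ n, σ n ^ 3 = n)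
    (ha : Tendsto (fun n => a n / (σ n : ℂ) ^ 2) atTop (nhds 0)) (P : Polynomial ℂ) :
    Tendsto (fun n : ℕ => ((n : ℂ) + 1)⁻¹ *
      (((SpPoly n (a n)).roots.map (fun z => z / (σ n : ℂ) ^ 4)).map (fun z => P.eval z)).sum) atTop
      (nhds (∫ z, P.eval z ∂nu)) := by
  induction P using Polynomial.induction_on' with
  | add p q hp hq =>
    simp only [Polynomial.eval_add]
    rw [integral_add (nu_integrable _ p.continuous) (nu_integrable _ q.continuous)]
    refine (hp.add hq).congr fun n => ?_
    rw [Multiset.sum_map_add, mul_add]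
  | monomial k c =>
    simp only [Polynomial.eval_monomial]
    rw [integral_const_mul, nu_moment]
    refine ((moments_tendsto σ a hσ h3 ha k).const_mul c).congr fun n => ?_
    rw [Multiset.sum_map_mul_left]; ring

theorem star3_sub (z : ℂ) (hz : z ∈ star3) : z ∈ Sset := by
  obtain ⟨j, -, r, hr, rfl⟩ := (mem_star3 z).1 hz
  refine ⟨?_, ?_⟩
  · rw [norm_mul, om_norm, mul_one, Complex.norm_real, Real.norm_eq_abs, abs_of_nonneg hr.1]
    linarith [hr.2]
  · rw [mul_pow, om_cube, mul_one, ← Complex.ofReal_pow, Complex.ofReal_im]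

theorem avg_norm_le (s : Multiset ℂ) (n : ℕ) (hs : s.card = n + 1) (h : ℂ → ℂ) (ε : ℝ)
    (hh : ∀ z ∈ s, ‖h z‖ ≤ ε) : ‖((n : ℂ) + 1)⁻¹ * (s.map h).sum‖ ≤ ε := by
  have h1 : ‖(s.map h).sum‖ ≤ s.card * ε := by
    clear hs
    induction s using Multiset.induction_on with
    | empty => simp
    | cons a s ih =>
      simp only [Multiset.map_cons, Multiset.sum_cons, Multiset.card_cons]
      have := ih fun z hz => hh z (Multiset.mem_cons_of_mem hz)
      have h2 := hh a (Multiset.mem_cons_self a s)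
      refine (norm_add_le _ _).trans ?_
      push_cast; linarith
  rw [hs] at h1
  have e : ‖((n : ℂ) + 1)⁻¹‖ = ((n : ℝ) + 1)⁻¹ := by
    rw [norm_inv]; norm_cast
  rw [norm_mul, e, inv_mul_le_iff₀ (by positivity)]
  push_cast at h1
  exact h1

theorem main_tendsto (σ : ℕ → ℝ) (a : ℕ → ℂ) (hσ : ∀ n, 1 ≤ n → 0 < σ n) (h3 : ∀ n, σ n ^ 3 = n)
    (ha : Tendsto (fun n => a n / (σ n : ℂ) ^ 2) atTop (nhds 0)) (f : ℂ → ℂ) (hf : Continuous f) :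
    Tendsto (fun n : ℕ => ((n : ℂ) + 1)⁻¹ *
      (((SpPoly n (a n)).roots.map (fun z => z / (σ n : ℂ) ^ 4)).map f).sum) atTop
      (nhds (∫ z, f z ∂nu)) := by
  have := nu_prob
  rw [Metric.tendsto_atTop']
  intro ε hε
  obtain ⟨P, hP⟩ := poly_dense f hf (ε / 3) (by positivity)
  have hcont : Continuous fun z : ℂ => ‖f z - P.eval z‖ := (hf.sub P.continuous).norm
  obtain ⟨κ, hκ, hκ'⟩ : ∃ κ > 0, ∀ z : ℂ, ‖z‖ ≤ 3 → |(z ^ 3).im| < κ → ‖f z - P.eval z‖ < ε / 3 := by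
    have hT : IsCompact (Metric.closedBall (0 : ℂ) 3 ∩ {z : ℂ | ε / 3 ≤ ‖f z - P.eval z‖}) :=
      (isCompact_closedBall (0 : ℂ) 3).inter_right (isClosed_le continuous_const hcont)
    have hc2 : ContinuousOn (fun z : ℂ => |(z ^ 3).im|)
        (Metric.closedBall (0 : ℂ) 3 ∩ {z : ℂ | ε / 3 ≤ ‖f z - P.eval z‖}) :=
      (Complex.continuous_im.comp (continuous_pow 3)).abs.continuousOn
    obtain ⟨κ, hκ, h⟩ := hT.exists_forall_le' hc2 (a := 0) (by
      rintro z ⟨hz1, hz2⟩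
      rw [abs_pos]
      intro h0
      have := hP z ⟨by simpa using hz1, h0⟩
      exact absurd hz2 (not_le.2 this))
    refine ⟨κ, hκ, fun z hz hz' => ?_⟩
    by_contra hcon
    push Not at hcon
    have := h z ⟨by simpa using hz, hcon⟩
    linarith
  have hloc := roots_location σ a hσ h3 ha κ hκ
  have hpol := (Metric.tendsto_nhds.1 (poly_tendsto σ a hσ h3 ha P)) (ε / 3) (by positivity)
  have hnu : ‖∫ z, P.eval z ∂nu - ∫ z, f z ∂nu‖ ≤ ε / 3 := by
    rw [← integral_sub (nu_integrable _ P.continuous) (nu_integrable _ hf)]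
    have := norm_integral_le_of_norm_le_const (μ := nu) (f := fun z => P.eval z - f z) (C := ε / 3)
      (nu_ae _ fun z hz => by rw [norm_sub_rev]; exact (hP z (star3_sub z hz)).le)
    simpa using this
  have hev := (hloc.and hpol)
  obtain ⟨N, hN⟩ := eventually_atTop.1 hev
  refine ⟨N, fun n hn => ?_⟩
  obtain ⟨g1, g2⟩ := hN n hn.le
  rw [dist_eq_norm] at g2 ⊢
  have g3 := avg_norm_le _ n (by rw [Multiset.card_map, roots_card]) (fun z => f z - P.eval z) (ε / 3)
    (fun z hz => (hκ' z (g1 z hz).1 (g1 z hz).2).le)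
  rw [Multiset.sum_map_sub, mul_sub] at g3
  have := norm_add₃_le (a := ((n : ℂ) + 1)⁻¹ *
      (((SpPoly n (a n)).roots.map (fun z => z / (σ n : ℂ) ^ 4)).map f).sum - ((n : ℂ) + 1)⁻¹ *
      (((SpPoly n (a n)).roots.map (fun z => z / (σ n : ℂ) ^ 4)).map (fun z => P.eval z)).sum)
    (b := ((n : ℂ) + 1)⁻¹ *
      (((SpPoly n (a n)).roots.map (fun z => z / (σ n : ℂ) ^ 4)).map (fun z => P.eval z)).sum
        - ∫ z, P.eval z ∂nu) (c := ∫ z, P.eval z ∂nu - ∫ z, f z ∂nu)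
  rw [sub_add_sub_cancel, sub_add_sub_cancel] at this
  linarith

/-- There is a probability measure `ν₀` whose support is the union of the three segments
joining `0` to `(3/4)·e^{2πij/3}`, `j = 0,1,2`, such that for any sequence `(a_n)` with
`a_n / n^{2/3} → 0` the root-counting measures of `β ↦ Sp_n(a_n, n^{4/3} β)` converge
weakly to `ν₀`. -/
theorem root_counting_measures_converge :
    ∃ ν : Measure ℂ, IsProbabilityMeasure ν ∧
      (∀ x : ℂ,
        (x ∈ ⋃ j ∈ Finset.range 3,
            segment ℝ (0 : ℂ)
              ((3 / 4 : ℂ) * Complex.exp (2 * Real.pi * Complex.I * (j : ℂ) / 3))) ↔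
          ∀ U ∈ nhds x, ν U ≠ 0) ∧
      ∀ a : ℕ → ℂ,
        Tendsto (fun n : ℕ => a n / (((n : ℝ) ^ ((2 : ℝ) / 3) : ℝ) : ℂ)) atTop (nhds 0) →
          ∀ f : ℂ →ᵇ ℝ,
            Tendsto (fun n : ℕ => ∫ x, f x ∂(rootMeasure n (a n))) atTop
              (nhds (∫ x, f x ∂ν)) := by

  refine ⟨nu, nu_prob, nu_support, fun a ha f => ?_⟩
  have hσ : ∀ n : ℕ, 1 ≤ n → 0 < (n : ℝ) ^ ((1 : ℝ) / 3) := fun n hn =>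
    Real.rpow_pos_of_pos (by exact_mod_cast hn) _
  have hpow : ∀ n k : ℕ, ((n : ℝ) ^ ((1 : ℝ) / 3)) ^ k = (n : ℝ) ^ ((k : ℝ) / 3) := by
    intro n k
    rw [← Real.rpow_natCast, ← Real.rpow_mul (Nat.cast_nonneg n)]
    congr 1; ring
  have h3 : ∀ n : ℕ, ((n : ℝ) ^ ((1 : ℝ) / 3)) ^ 3 = n := by
    intro n
    rw [hpow]; norm_num
  have h2 : ∀ n : ℕ, (((n : ℝ) ^ ((1 : ℝ) / 3) : ℝ) : ℂ) ^ 2 = (((n : ℝ) ^ ((2 : ℝ) / 3) : ℝ) : ℂ) := by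
    intro n
    rw [← Complex.ofReal_pow, hpow]; norm_num
  have h4 : ∀ n : ℕ, (((n : ℝ) ^ ((1 : ℝ) / 3) : ℝ) : ℂ) ^ 4 = (((n : ℝ) ^ ((4 : ℝ) / 3) : ℝ) : ℂ) := by
    intro n
    rw [← Complex.ofReal_pow, hpow]; norm_num
  have hm := main_tendsto (fun n => (n : ℝ) ^ ((1 : ℝ) / 3)) a hσ h3 (by simpa only [h2] using ha)
    (fun z => ((f z : ℝ) : ℂ)) (by fun_prop)
  simp only [h4] at hm
  rw [integral_complex_ofReal] at hm
  have hre := (Complex.continuous_re.tendsto _).comp hm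
  rw [Complex.ofReal_re] at hre
  refine hre.congr fun n => ?_
  rw [root_integral]
  have e : ∀ s : Multiset ℂ, (s.map (fun z => ((f z : ℝ) : ℂ))).sum = (((s.map f).sum : ℝ) : ℂ) := by
    intro s
    induction s using Multiset.induction_on with
    | empty => simp
    | cons a s ih => simp [ih]
  rw [Function.comp_apply, e]
  have e2 : ((n : ℂ) + 1)⁻¹ = ((((n : ℝ) + 1)⁻¹ : ℝ) : ℂ) := by push_cast; rfl
  rw [e2, ← Complex.ofReal_mul, Complex.ofReal_re]
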